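/- Let λ ∈ h* satisfy λ(z) ≠ 0 and set U_λ := U / U·m_λ, where m_λ ⊂ Z(s) is generated by z - λ(z) and c - ϑ_λ. Then: (i) if λ(h) ∉ 1/2 + ℤ or λ(h) = -3/2, the algebra U_λ is simple; (ii) if λ(h) ∈ {-1/2, 1/2, 3/2, 5/2, ...}, then U_λ has exactly two primitive ideals, namely 0 and the image of Ann_U(L(λ)). -/

import Mathlib

set_option maxSynthPendingDepth 3

namespace Schrodinger

noncomputable section

open scoped TensorProduct

/-- Generators of the Schrödinger algebra. -/
inductive Gen : Type
  | E | H | F | P | Q | Z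
  deriving DecidableEq

/-- The free algebra on the generators. -/
abbrev FA : Type := FreeAlgebra ℂ Gen

/-- Inclusion of generators. -/
def ιg (g : Gen) : FA := FreeAlgebra.ι ℂ g

/-- The defining relations of the universal enveloping algebra of the Schrödinger
algebra `s`: `z` is central and `[h,e]=2e`, `[e,f]=h`, `[h,f]=-2f`, `[e,q]=p`,
`[e,p]=0`, `[h,p]=p`, `[f,p]=q`, `[f,q]=0`, `[h,q]=-q`, `[p,q]=z`. -/
inductive Rel : FA → FA → Prop
  | he : Rel (ιg .H * ιg .E) (ιg .E * ιg .H + 2 * ιg .E)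
  | ef : Rel (ιg .E * ιg .F) (ιg .F * ιg .E + ιg .H)
  | hf : Rel (ιg .H * ιg .F) (ιg .F * ιg .H - 2 * ιg .F)
  | eq : Rel (ιg .E * ιg .Q) (ιg .Q * ιg .E + ιg .P)
  | ep : Rel (ιg .E * ιg .P) (ιg .P * ιg .E)
  | hp : Rel (ιg .H * ιg .P) (ιg .P * ιg .H + ιg .P)
  | fp : Rel (ιg .F * ιg .P) (ιg .P * ιg .F + ιg .Q)
  | fq : Rel (ιg .F * ιg .Q) (ιg .Q * ιg .F)
  | hq : Rel (ιg .H * ιg .Q) (ιg .Q * ιg .H - ιg .Q)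
  | pq : Rel (ιg .P * ιg .Q) (ιg .Q * ιg .P + ιg .Z)
  | ze : Rel (ιg .Z * ιg .E) (ιg .E * ιg .Z)
  | zh : Rel (ιg .Z * ιg .H) (ιg .H * ιg .Z)
  | zf : Rel (ιg .Z * ιg .F) (ιg .F * ιg .Z)
  | zp : Rel (ιg .Z * ιg .P) (ιg .P * ιg .Z)
  | zq : Rel (ιg .Z * ιg .Q) (ιg .Q * ιg .Z)

/-- The universal enveloping algebra `U = U(s)` of the Schrödinger algebra,
presented by generators and relations (via the PBW theorem). -/
abbrev U : Type := RingQuot Rel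

/-- The generators of `U`. -/
def gen (g : Gen) : U := RingQuot.mkAlgHom ℂ Rel (ιg g)

def E : U := gen .E
def H : U := gen .H
def F : U := gen .F
def P : U := gen .P
def Q : U := gen .Q
def Z : U := gen .Z

/-- Scalars inside `U`. -/
def sc (a : ℂ) : U := algebraMap ℂ U a

/-- The Casimir element `c = (h² + h + 4fe)z − 2(fp² − eq² − hpq)`. -/
def cElt : U := (H * H + H + 4 * (F * E)) * Z - 2 * (F * (P * P) - E * (Q * Q) - H * (P * Q))

/-- The left ideal of `U` defining the Verma module `Δ(λ)` for
`λ ∈ 𝔥*` with `λ(h) = hh`, `λ(z) = zz`:  it is generated by `n₊ = span{e,p}`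
together with `h - λ(h)` and `z - λ(z)`; then
`Δ(λ) = U ⊗_{U(𝔟)} ℂ_λ ≅ U / U(e, p, h - λ(h), z - λ(z))`. -/
def vermaIdeal (hh zz : ℂ) : Submodule U U :=
  Submodule.span U ({E, P, H - sc hh, Z - sc zz} : Set U)

/-- The Verma module `Δ(λ)` with highest weight `λ`, `λ(h) = hh`, `λ(z) = zz`. -/
abbrev Verma (hh zz : ℂ) : Type := U ⧸ vermaIdeal hh zz

/-- The canonical highest weight generator `v_λ` of `Δ(λ)`. -/
def hwVec (hh zz : ℂ) : Verma hh zz := Submodule.Quotient.mk 1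

/-- The unique maximal submodule `K(λ)` of `Δ(λ)`. -/
def vermaRad (hh zz : ℂ) : Submodule U (Verma hh zz) := sSup {N : Submodule U (Verma hh zz) | N ≠ ⊤}

/-- The simple highest weight module `L(λ) = Δ(λ)/K(λ)`. -/
abbrev SimpleHW (hh zz : ℂ) : Type := Verma hh zz ⧸ vermaRad hh zz

/-- The scalar `ϑ_λ = (λ(h)² + 3λ(h) + 2)·λ(z)` by which the Casimir element `c`
acts on the Verma module `Δ(λ)`. -/
def vartheta (hh zz : ℂ) : ℂ := (hh ^ 2 + 3 * hh + 2) * zz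

end

end Schrodinger

namespace Schrodinger

noncomputable section

open CategoryTheory

/-- The `ℂ`-vector space structure on a `U`-module, obtained by restricting
scalars along `ℂ → U`. -/
def cmod (M : Type) [AddCommGroup M] [Module U M] : Module ℂ M :=
  Module.compHom M (algebraMap ℂ U)

/-- `v` is a weight vector of weight `λ` with `λ(h) = hh` and `λ(z) = zz`. -/
def IsWeightVec {M : Type} [AddCommGroup M] [Module U M] (hh zz : ℂ) (v : M) : Prop :=
  H • v = sc hh • v ∧ Z • v = sc zz • v

/-- The subalgebra `U(n₊)` of `U` generated by `n₊ = span{e, p}`. -/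
def nPlus : Subalgebra ℂ U := Algebra.adjoin ℂ ({E, P} : Set U)

/-- Membership in category `O`: finitely generated, a (direct) sum of its
weight spaces, and locally `U(n₊)`-finite. -/
def InO (M : Type) [AddCommGroup M] [Module U M] : Prop :=
  Module.Finite U M ∧
  (∀ v : M, v ∈ AddSubgroup.closure {w : M | ∃ hh zz : ℂ, IsWeightVec hh zz w}) ∧
  (letI := cmod M
   ∀ v : M, ∃ W : Submodule ℂ M, FiniteDimensional ℂ W ∧ ∀ u ∈ nPlus, u • v ∈ W)

/-- Membership in the block `O[ξ]`, where `ξ ∈ 𝔥*/ℤR` is the class of the weight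
`(hh0, zz0)` (so that the weights in `ξ` are exactly `(hh0 + n, zz0)`, `n ∈ ℤ`):
the module is in `O` and all its weights lie in `ξ`. -/
def InBlock (hh0 zz0 : ℂ) (M : ModuleCat.{0} U) : Prop :=
  InO M ∧
  ∀ (v : M) (hh zz : ℂ), v ≠ 0 → IsWeightVec hh zz v → zz = zz0 ∧ ∃ n : ℤ, hh = hh0 + n

/-- The Verma module as an object of the category of `U`-modules. -/
def VermaC (hh zz : ℂ) : ModuleCat.{0} U := ModuleCat.of U (Verma hh zz)

/-- `Pc` is a Serre class inside the subcategory (of the category of `U`-modules)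
cut out by `Oc`: it is contained in `Oc`, closed under isomorphism, and for every
short exact sequence `0 → N → M → M/N → 0` in `Oc`, `M` belongs to `Pc` if and only
if both `N` and `M/N` do. -/
def SerreClassIn (Oc Pc : ModuleCat.{0} U → Prop) : Prop :=
  (∀ M, Pc M → Oc M) ∧
  (∀ M N : ModuleCat.{0} U, Nonempty ((M : Type) ≃ₗ[U] (N : Type)) → Pc M → Oc N → Pc N) ∧
  (∀ (M : ModuleCat.{0} U) (N : Submodule U M), Oc M →
      (Pc M ↔ Pc (ModuleCat.of U N) ∧ Pc (ModuleCat.of U ((M : Type) ⧸ N))))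

/-- Membership in the Serre subcategory of the subcategory cut out by `Oc`
generated by the set of objects `S`. -/
def InSerreGen (Oc : ModuleCat.{0} U → Prop) (S : Set (ModuleCat.{0} U))
    (M : ModuleCat.{0} U) : Prop :=
  Oc M ∧ ∀ Pc : ModuleCat.{0} U → Prop, SerreClassIn Oc Pc → (∀ X ∈ S, Pc X) → Pc M

end

end Schrodinger

namespace Schrodinger

noncomputable section

/-- The relations defining the central quotient `U_λ = U/U·m_λ`:  the central
element `z` is identified with the scalar `λ(z)` and the Casimir element `c`
with the scalar `ϑ_λ = (λ(h)² + 3λ(h) + 2)λ(z)`. -/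
inductive CRel (hh zz : ℂ) : U → U → Prop
  | z : CRel hh zz Z (sc zz)
  | c : CRel hh zz cElt (sc (vartheta hh zz))

/-- The central quotient `U_λ := U/U·m_λ`, where `m_λ ⊂ Z(s)` is the maximal
ideal generated by `z - λ(z)` and `c - ϑ_λ`. -/
abbrev UQuot (hh zz : ℂ) : Type := RingQuot (CRel hh zz)

/-- The quotient map `U → U_λ`. -/
def uquotMap (hh zz : ℂ) : U →+* UQuot hh zz := RingQuot.mkRingHom (CRel hh zz)

/-- A two-sided ideal of a ring is primitive if it is the annihilator of a
simple module. -/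
def IsPrimitiveIdeal {R : Type} [Ring R] (I : TwoSidedIdeal R) : Prop :=
  ∃ M : ModuleCat.{0} R, IsSimpleModule R M ∧ ∀ x : R, x ∈ I ↔ ∀ v : M, x • v = 0

end

end Schrodinger

namespace Schrodinger

section

open Polynomial

theorem smul_mem_of_adjoin_eq_top {R M : Type*} [Ring R] [Algebra ℂ R] [AddCommGroup M]
    [Module ℂ M] [Module R M] [IsScalarTower ℂ R M] {S : Set R} (hS : Algebra.adjoin ℂ S = ⊤)
    (W : Submodule ℂ M) (hW : ∀ s ∈ S, ∀ x ∈ W, s • x ∈ W) (r : R) {x : M} (hx : x ∈ W) :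
    r • x ∈ W := by
  have hr : r ∈ Algebra.adjoin ℂ S := hS ▸ Algebra.mem_top
  induction hr using Algebra.adjoin_induction generalizing x with
  | mem s hs => exact hW s hs x hx
  | algebraMap c => rw [algebraMap_smul]; exact W.smul_mem c hx
  | add a b _ _ ha hb => rw [add_smul]; exact W.add_mem (ha hx) (hb hx)
  | mul a b _ _ ha hb => rw [mul_smul]; exact ha (hb hx)

theorem smul_complex_smul {R M : Type*} [Ring R] [Algebra ℂ R] [AddCommGroup M]
    [Module ℂ M] [Module R M] [IsScalarTower ℂ R M] (r : R) (c : ℂ) (x : M) :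
    r • c • x = c • r • x := by
  rw [← algebraMap_smul R c x, ← algebraMap_smul R c (r • x), smul_smul, smul_smul,
    Algebra.commutes]

/-- If a sum of simultaneous eigenvectors lies in a stable subspace `N`, then so does every
summand whose system of eigenvalues is separated from those of the other summands. -/
theorem eigencomponent_mem {ι M : Type*} [AddCommGroup M] [Module ℂ M] (N : Submodule ℂ M)
    (s : Finset ι) (x : ι → M) (x₀ : M)
    (h : ∀ i ∈ s, ∃ (T : M →ₗ[ℂ] M) (t : ι → ℂ) (t₀ : ℂ), (∀ y ∈ N, T y ∈ N) ∧
      T x₀ = t₀ • x₀ ∧ (∀ j ∈ s, T (x j) = t j • x j) ∧ t i ≠ t₀)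
    (hx : x₀ + ∑ i ∈ s, x i ∈ N) : x₀ ∈ N := by
  classical
  induction s using Finset.induction_on generalizing x x₀ with
  | empty => simpa using hx
  | insert a s ha ih =>
    obtain ⟨T, t, t₀, hN, h₀, ht, hne⟩ := h a (Finset.mem_insert_self _ _)
    have key : (t₀ - t a) • x₀ ∈ N := by
      refine ih (fun i => (t i - t a) • x i) ((t₀ - t a) • x₀) ?_ ?_
      · intro i hi
        obtain ⟨T', t', t₀', hN', h₀', ht', hne'⟩ := h i (Finset.mem_insert_of_mem hi)
        refine ⟨T', t', t₀', hN', ?_, ?_, hne'⟩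
        · rw [map_smul, h₀', smul_comm]
        · intro j hj
          rw [map_smul, ht' j (Finset.mem_insert_of_mem hj), smul_comm]
      · have h1 := N.sub_mem (hN _ hx) (N.smul_mem (t a) hx)
        convert h1 using 1
        rw [Finset.sum_insert ha, map_add, map_add, map_sum, h₀, ht a (Finset.mem_insert_self _ _),
          Finset.sum_congr rfl (fun j hj => ht j (Finset.mem_insert_of_mem hj)), smul_add, smul_add,
          Finset.smul_sum]
        simp only [sub_smul, Finset.sum_sub_distrib]
        abel
    exact (N.smul_mem_iff (sub_ne_zero.2 (Ne.symm hne))).1 key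

/-- Elements `p, q, e, f, h` of an algebra such that `[p, q] = zz`, the elements `e, f, h` form an
`sl₂`-triple commuting with `p` and `q`, and the Casimir element `h² + 2h + 4fe` acts
by `μ² + 2μ`. -/
structure IsWeylTriple {R : Type*} [Ring R] [Algebra ℂ R] (zz μ : ℂ) (p q e f h : R) : Prop where
  pq : p * q = q * p + zz • 1
  pe : p * e = e * p
  pf : p * f = f * p
  ph : p * h = h * p
  qe : q * e = e * q
  qf : q * f = f * q
  qh : q * h = h * q
  he : h * e = e * h + (2 : ℂ) • e
  hf : h * f = f * h - (2 : ℂ) • f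
  ef : e * f = f * e + h
  cas : f * e = (1 / 4 : ℂ) • ((μ ^ 2 + 2 * μ) • (1 : R) - h * h - (2 : ℂ) • h)

theorem IsWeylTriple.map {R S : Type*} [Ring R] [Algebra ℂ R] [Ring S] [Algebra ℂ S]
    {zz μ : ℂ} {p q e f h : R} (H : IsWeylTriple zz μ p q e f h) (φ : R →ₐ[ℂ] S) :
    IsWeylTriple zz μ (φ p) (φ q) (φ e) (φ f) (φ h) where
  pq := by rw [← map_mul, H.pq]; simp
  pe := by rw [← map_mul, H.pe]; simp
  pf := by rw [← map_mul, H.pf]; simp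
  ph := by rw [← map_mul, H.ph]; simp
  qe := by rw [← map_mul, H.qe]; simp
  qf := by rw [← map_mul, H.qf]; simp
  qh := by rw [← map_mul, H.qh]; simp
  he := by rw [← map_mul, H.he]; simp
  hf := by rw [← map_mul, H.hf]; simp
  ef := by rw [← map_mul, H.ef]; simp
  cas := by rw [← map_mul, H.cas]; simp

/-- The powers of `e` and `f`, indexed by half of their weight. -/
def weightMonomial {R : Type*} [Ring R] (e f : R) : ℤ → R
  | Int.ofNat n => e ^ n
  | Int.negSucc n => f ^ (n + 1)

/-- The value of `fe` as a polynomial in `h`. -/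
noncomputable def fePoly (μ : ℂ) : ℂ[X] := C (1 / 4) * (C (μ ^ 2 + 2 * μ) - X * X - C 2 * X)

theorem fePoly_add_X_ne_zero (μ : ℂ) : fePoly μ + X ≠ 0 := by
  intro h
  have h0 := congrArg (eval 0) h
  have h1 := congrArg (eval 1) h
  have h2 := congrArg (eval 2) h
  simp only [fePoly, eval_add, eval_mul, eval_sub, eval_C, eval_X, eval_zero] at h0 h1 h2
  have : (1 : ℂ) = 0 := by linear_combination 4 * h1 - 2 * h0 - 2 * h2
  exact one_ne_zero this

theorem aeval_mul_of_semiconj {R : Type*} [Ring R] [Algebra ℂ R] {h y : R} {c : ℂ}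
    (hy : h * y = y * h + c • y) (g : ℂ[X]) :
    aeval h g * y = y * aeval h (g.comp (X + C c)) := by
  induction g using Polynomial.induction_on' with
  | add a b ha hb => simp only [map_add, add_mul, mul_add, add_comp, ha, hb]
  | monomial n a =>
    have hy' : SemiconjBy y (h + c • 1) h := by
      rw [SemiconjBy, hy, mul_add, mul_smul_comm, mul_one]
    rw [← C_mul_X_pow_eq_monomial]
    simp only [map_mul, map_pow, aeval_X, aeval_C, mul_comp, C_comp, pow_comp, X_comp, map_add]
    rw [mul_assoc, ← Algebra.smul_def, ← Algebra.smul_def, Algebra.algebraMap_eq_smul_one,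
      mul_smul_comm, (hy'.pow_right n).eq]

namespace IsWeylTriple

section Algebra

variable {R : Type*} [Ring R] [Algebra ℂ R] {zz μ : ℂ} {p q e f h : R}

section
variable (H : IsWeylTriple zz μ p q e f h)
include H

theorem fe_eq : f * e = aeval h (fePoly μ) := by
  rw [H.cas]
  simp [fePoly, Algebra.smul_def, map_ofNat]

theorem ef_eq : e * f = aeval h (fePoly μ + X) := by
  rw [H.ef, H.fe_eq, map_add, aeval_X]

theorem aeval_mul_e_pow (g : ℂ[X]) (n : ℕ) :
    aeval h g * e ^ n = e ^ n * aeval h (g.comp (X + C (2 * n : ℂ))) := by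
  refine aeval_mul_of_semiconj ?_ g
  induction n with
  | zero => simp
  | succ n ih =>
    rw [pow_succ, ← mul_assoc, ih, add_mul, mul_assoc, H.he]
    simp only [mul_add, mul_assoc, smul_mul_assoc, mul_smul_comm]
    push_cast
    module

theorem aeval_mul_f_pow (g : ℂ[X]) (n : ℕ) :
    aeval h g * f ^ n = f ^ n * aeval h (g.comp (X + C (-(2 * n : ℂ)))) := by
  refine aeval_mul_of_semiconj ?_ g
  induction n with
  | zero => simp
  | succ n ih =>
    rw [pow_succ, ← mul_assoc, ih, add_mul, mul_assoc, H.hf]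
    simp only [mul_sub, mul_assoc, smul_mul_assoc, mul_smul_comm]
    push_cast
    module

theorem aeval_mul_weightMonomial (g : ℂ[X]) (k : ℤ) :
    aeval h g * weightMonomial e f k =
      weightMonomial e f k * aeval h (g.comp (X + C (2 * k : ℂ))) := by
  cases k with
  | ofNat n => simpa [weightMonomial] using H.aeval_mul_e_pow g n
  | negSucc n =>
    have hc : (2 * (Int.negSucc n : ℤ) : ℂ) = -(2 * (n + 1 : ℕ)) := by push_cast; ring
    rw [hc]
    exact H.aeval_mul_f_pow g (n + 1)

theorem h_mul_weightMonomial (k : ℤ) :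
    h * weightMonomial e f k = weightMonomial e f k * h + (2 * k : ℂ) • weightMonomial e f k := by
  have := H.aeval_mul_weightMonomial X k
  rwa [X_comp, map_add, aeval_X, aeval_C, mul_add, ← Algebra.commutes, ← Algebra.smul_def] at this

theorem exists_e_mul_weightMonomial (k : ℤ) : ∃ r : ℂ[X], r ≠ 0 ∧
    e * weightMonomial e f k = weightMonomial e f (k + 1) * aeval h r := by
  match k with
  | Int.ofNat n => exact ⟨1, one_ne_zero, by simp [weightMonomial, ← pow_succ']; rfl⟩
  | Int.negSucc 0 => exact ⟨_, fePoly_add_X_ne_zero μ, by simp [weightMonomial, H.ef_eq]⟩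
  | Int.negSucc (n + 1) =>
    refine ⟨(fePoly μ + X).comp (X + C (2 * (Int.negSucc n : ℤ) : ℂ)), ?_, ?_⟩
    · rw [Ne, comp_eq_zero_iff, not_or]
      refine ⟨fePoly_add_X_ne_zero μ, fun h => ?_⟩
      have := congrArg (coeff · 1) h.2
      simp [coeff_C] at this
    · have : Int.negSucc (n + 1) + 1 = Int.negSucc n := rfl
      rw [this, ← H.aeval_mul_weightMonomial, ← H.ef_eq]
      simp only [weightMonomial]
      rw [pow_succ' f (n + 1), mul_assoc]

theorem exists_weightMonomial_mul_e (k : ℤ) : ∃ r : ℂ[X],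
    weightMonomial e f k * e = weightMonomial e f (k + 1) * aeval h r := by
  match k with
  | Int.ofNat n => exact ⟨1, by simp [weightMonomial, ← pow_succ]; rfl⟩
  | Int.negSucc 0 => exact ⟨_, by simpa [weightMonomial] using H.fe_eq⟩
  | Int.negSucc (n + 1) =>
    refine ⟨fePoly μ, ?_⟩
    have : Int.negSucc (n + 1) + 1 = Int.negSucc n := rfl
    rw [this, ← H.fe_eq]
    simp only [weightMonomial]
    rw [pow_succ f (n + 1), mul_assoc]

theorem exists_f_mul_weightMonomial (k : ℤ) : ∃ r : ℂ[X],
    f * weightMonomial e f k = weightMonomial e f (k - 1) * aeval h r := by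
  match k with
  | Int.ofNat 0 => exact ⟨1, by change f * e ^ 0 = f ^ (0 + 1) * _; simp⟩
  | Int.ofNat (n + 1) =>
    refine ⟨(fePoly μ).comp (X + C (2 * (n : ℕ) : ℂ)), ?_⟩
    have : Int.ofNat (n + 1) - 1 = Int.ofNat n := by simp
    rw [this]
    simp only [weightMonomial]
    rw [← H.aeval_mul_e_pow, ← H.fe_eq, pow_succ', mul_assoc]
  | Int.negSucc n => exact ⟨1, by simp [weightMonomial, ← pow_succ']⟩

theorem p_mul_weightMonomial (k : ℤ) : p * weightMonomial e f k = weightMonomial e f k * p := by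
  cases k with
  | ofNat n => exact (show Commute p e from H.pe).pow_right n
  | negSucc n => exact (show Commute p f from H.pf).pow_right (n + 1)

theorem q_mul_weightMonomial (k : ℤ) : q * weightMonomial e f k = weightMonomial e f k * q := by
  cases k with
  | ofNat n => exact (show Commute q e from H.qe).pow_right n
  | negSucc n => exact (show Commute q f from H.qf).pow_right (n + 1)

theorem commute_p_aeval (g : ℂ[X]) : Commute p (aeval h g) := by
  have := aeval_mul_of_semiconj (h := h) (y := p) (c := 0) (by rw [H.ph]; simp) g
  rw [C_0, add_zero, comp_X] at this
  exact this.symm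

theorem commute_q_aeval (g : ℂ[X]) : Commute q (aeval h g) := by
  have := aeval_mul_of_semiconj (h := h) (y := q) (c := 0) (by rw [H.qh]; simp) g
  rw [C_0, add_zero, comp_X] at this
  exact this.symm

theorem p_mul_q_pow_succ (i : ℕ) : p * q ^ (i + 1) = q ^ (i + 1) * p + ((i + 1) * zz) • q ^ i := by
  induction i with
  | zero => simpa using H.pq
  | succ i ih =>
    rw [pow_succ q (i + 1), ← mul_assoc, ih, add_mul, mul_assoc, H.pq, ← pow_succ]
    simp only [mul_add, ← mul_assoc, smul_mul_assoc, mul_smul_comm, ← pow_succ, mul_one]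
    push_cast
    module

theorem p_pow_succ_mul_q (i : ℕ) : p ^ (i + 1) * q = q * p ^ (i + 1) + ((i + 1) * zz) • p ^ i := by
  induction i with
  | zero => simpa using H.pq
  | succ i ih =>
    rw [pow_succ' p (i + 1), mul_assoc, ih, mul_add, ← mul_assoc, H.pq]
    simp only [add_mul, mul_assoc, smul_mul_assoc, mul_smul_comm, ← pow_succ', one_mul]
    push_cast
    module

end

variable (p q e f h) in
/-- The span of the ordered monomials `qⁱ b pʲ`, where `b` has weight `2k` in the subalgebra
generated by the `sl₂`-triple. -/
noncomputable def monomialSpan (t : ℕ × ℕ × ℤ) : Submodule ℂ R :=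
  LinearMap.range ((LinearMap.mulRight ℂ (p ^ t.2.1)).comp
    ((LinearMap.mulLeft ℂ (q ^ t.1 * weightMonomial e f t.2.2)).comp (aeval h).toLinearMap))

theorem mem_monomialSpan {t : ℕ × ℕ × ℤ} {x : R} : x ∈ monomialSpan p q e f h t ↔
    ∃ g : ℂ[X], x = q ^ t.1 * (weightMonomial e f t.2.2 * aeval h g) * p ^ t.2.1 := by
  simp [monomialSpan, mul_assoc, eq_comm]

theorem mem_iSup_monomialSpan (i j : ℕ) (k : ℤ) (g : ℂ[X]) :
    q ^ i * (weightMonomial e f k * aeval h g) * p ^ j ∈ ⨆ t, monomialSpan p q e f h t :=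
  Submodule.mem_iSup_of_mem (i, j, k) (mem_monomialSpan.2 ⟨g, rfl⟩)

theorem iSup_monomialSpan (H : IsWeylTriple zz μ p q e f h)
    (hgen : Algebra.adjoin ℂ {p, q, e, f, h} = ⊤) : ⨆ t, monomialSpan p q e f h t = ⊤ := by
  set W := ⨆ t, monomialSpan p q e f h t with hWdef
  have closed (s : R) (hs : ∀ (i j : ℕ) (k : ℤ) (g : ℂ[X]),
      s * (q ^ i * (weightMonomial e f k * aeval h g) * p ^ j) ∈ W) : ∀ x ∈ W, s • x ∈ W := by
    have : W ≤ W.comap (LinearMap.mulLeft ℂ s) := by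
      refine iSup_le fun t x hx => ?_
      obtain ⟨g, rfl⟩ := mem_monomialSpan.1 hx
      exact hs _ _ _ _
    exact this
  have hW : ∀ s ∈ ({p, q, e, f, h} : Set R), ∀ x ∈ W, s • x ∈ W := by
    rintro s (rfl | rfl | rfl | rfl | rfl) <;> refine closed _ fun i j k g => ?_
    · have h1 : s * (weightMonomial e f k * aeval h g) = weightMonomial e f k * aeval h g * s :=
        ((show Commute s _ from H.p_mul_weightMonomial k).mul_right (H.commute_p_aeval g)).eq
      have h2 : q ^ i * s * (weightMonomial e f k * aeval h g) * s ^ j =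
          q ^ i * (weightMonomial e f k * aeval h g) * s ^ (j + 1) := by
        rw [mul_assoc (q ^ i), h1, pow_succ']; simp only [mul_assoc]
      cases i with
      | zero =>
        have := mem_iSup_monomialSpan (p := s) (q := q) (e := e) (f := f) (h := h) 0 (j + 1) k g
        rw [← h2] at this
        simpa [mul_assoc] using this
      | succ i =>
        have : s * (q ^ (i + 1) * (weightMonomial e f k * aeval h g) * s ^ j) =
            q ^ (i + 1) * (weightMonomial e f k * aeval h g) * s ^ (j + 1) +
            ((i + 1) * zz) • (q ^ i * (weightMonomial e f k * aeval h g) * s ^ j) := by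
          rw [← h2, ← mul_assoc, ← mul_assoc, H.p_mul_q_pow_succ]
          simp only [add_mul, smul_mul_assoc]
        rw [this]
        exact W.add_mem (mem_iSup_monomialSpan _ _ _ _)
          (W.smul_mem _ (mem_iSup_monomialSpan _ _ _ _))
    · have := mem_iSup_monomialSpan (p := p) (q := s) (e := e) (f := f) (h := h) (i + 1) j k g
      simpa only [pow_succ', mul_assoc] using this
    · obtain ⟨r, -, hr⟩ := H.exists_e_mul_weightMonomial k
      have := mem_iSup_monomialSpan (p := p) (q := q) (e := s) (f := f) (h := h) i j (k + 1) (r * g)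
      rw [map_mul, ← mul_assoc (weightMonomial s f (k + 1)), ← hr, ← mul_assoc (q ^ i),
        ← mul_assoc (q ^ i), ((show Commute q s from H.qe).pow_left i).eq] at this
      simpa only [mul_assoc] using this
    · obtain ⟨r, hr⟩ := H.exists_f_mul_weightMonomial k
      have := mem_iSup_monomialSpan (p := p) (q := q) (e := e) (f := s) (h := h) i j (k - 1) (r * g)
      rw [map_mul, ← mul_assoc (weightMonomial e s (k - 1)), ← hr, ← mul_assoc (q ^ i),
        ← mul_assoc (q ^ i), ((show Commute q s from H.qf).pow_left i).eq] at this
      simpa only [mul_assoc] using this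
    · have hr := H.aeval_mul_weightMonomial X k
      have := mem_iSup_monomialSpan (p := p) (q := q) (e := e) (f := f) (h := s) i j k
        (X.comp (X + C (2 * k : ℂ)) * g)
      rw [map_mul, ← mul_assoc (weightMonomial e f k), ← hr, ← mul_assoc (q ^ i),
        ← mul_assoc (q ^ i), aeval_X, ((show Commute q s from H.qh).pow_left i).eq] at this
      simpa only [mul_assoc] using this
  refine eq_top_iff.2 fun r _ => ?_
  have h1 : (1 : R) ∈ W := by
    have := mem_iSup_monomialSpan (p := p) (q := q) (e := e) (f := f) (h := h) 0 0 (Int.ofNat 0) 1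
    simpa [weightMonomial] using this
  simpa using smul_mem_of_adjoin_eq_top hgen W hW r h1

theorem mem_of_q_pow_mul_mem (H : IsWeylTriple zz μ p q e f h) (hzz : zz ≠ 0)
    (I : TwoSidedIdeal R) {x : R} (hx : Commute p x) (i : ℕ) (hi : q ^ i * x ∈ I) : x ∈ I := by
  induction i with
  | zero => simpa using hi
  | succ i ih =>
    refine ih ?_
    have h1 : p * (q ^ (i + 1) * x) - q ^ (i + 1) * x * p = ((i + 1) * zz) • (q ^ i * x) := by
      rw [← mul_assoc, H.p_mul_q_pow_succ, mul_assoc _ x, ← hx.eq, add_mul, smul_mul_assoc,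
        mul_assoc]
      abel
    have h2 := I.sub_mem (I.mul_mem_left p _ hi) (I.mul_mem_right _ p hi)
    rw [h1] at h2
    have h3 := I.mul_mem_left (algebraMap ℂ R ((i + 1) * zz)⁻¹) _ h2
    rwa [← Algebra.smul_def, inv_smul_smul₀] at h3
    exact mul_ne_zero (by exact_mod_cast i.succ_ne_zero) hzz

theorem mem_of_mul_p_pow_mem (H : IsWeylTriple zz μ p q e f h) (hzz : zz ≠ 0)
    (I : TwoSidedIdeal R) {x : R} (hx : Commute q x) (i : ℕ) (hi : x * p ^ i ∈ I) : x ∈ I := by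
  induction i with
  | zero => simpa using hi
  | succ i ih =>
    refine ih ?_
    have h1 : x * p ^ (i + 1) * q - q * (x * p ^ (i + 1)) = ((i + 1) * zz) • (x * p ^ i) := by
      rw [mul_assoc, H.p_pow_succ_mul_q, ← mul_assoc q, hx.eq, mul_add, mul_smul_comm, mul_assoc]
      abel
    have h2 := I.sub_mem (I.mul_mem_right _ q hi) (I.mul_mem_left q _ hi)
    rw [h1] at h2
    have h3 := I.mul_mem_left (algebraMap ℂ R ((i + 1) * zz)⁻¹) _ h2
    rwa [← Algebra.smul_def, inv_smul_smul₀] at h3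
    exact mul_ne_zero (by exact_mod_cast i.succ_ne_zero) hzz

/-- Every nonzero two-sided ideal contains a nonzero weight vector commuting with `p` and `q`. -/
theorem exists_weight_mem (H : IsWeylTriple zz μ p q e f h)
    (hgen : Algebra.adjoin ℂ {p, q, e, f, h} = ⊤) (hzz : zz ≠ 0) (I : TwoSidedIdeal R) {x : R}
    (hx : x ∈ I) (hx0 : x ≠ 0) : ∃ (k : ℤ) (g : ℂ[X]),
      weightMonomial e f k * aeval h g ∈ I ∧ weightMonomial e f k * aeval h g ≠ 0 := by
  classical
  have hxW : x ∈ ⨆ t, monomialSpan p q e f h t := by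
    rw [H.iSup_monomialSpan hgen]; exact Submodule.mem_top
  obtain ⟨y, hy, hyx⟩ := (Submodule.mem_iSup_iff_exists_finsupp _ _).1 hxW
  have hyne : y ≠ 0 := by
    rintro rfl
    exact hx0 (by rw [← hyx]; simp)
  obtain ⟨t₀, ht₀⟩ := Finsupp.support_nonempty_iff.2 hyne
  let N : Submodule ℂ R :=
    { carrier := {r | r ∈ I}
      add_mem' := fun ha hb => I.add_mem ha hb
      zero_mem' := I.zero_mem
      smul_mem' := fun c r hr => by
        rw [Set.mem_ofPred_eq, Algebra.smul_def]
        exact I.mul_mem_left _ _ hr }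
  have comm (g : ℂ[X]) (k : ℤ) : Commute p (weightMonomial e f k * aeval h g) ∧
      Commute q (weightMonomial e f k * aeval h g) :=
    ⟨(show Commute _ _ from H.p_mul_weightMonomial k).mul_right (H.commute_p_aeval g),
      (show Commute _ _ from H.q_mul_weightMonomial k).mul_right (H.commute_q_aeval g)⟩
  have hmem : y t₀ ∈ N := by
    refine eigencomponent_mem N (y.support.erase t₀) y (y t₀) ?_ ?_
    · intro t ht
      have hne : t ≠ t₀ := Finset.ne_of_mem_erase ht
      suffices ∃ (T : R →ₗ[ℂ] R) (c : ℕ × ℕ × ℤ → ℂ), (∀ z ∈ N, T z ∈ N) ∧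
          (∀ s, T (y s) = c s • y s) ∧ c t ≠ c t₀ by
        obtain ⟨T, c, h1, h2, h3⟩ := this
        exact ⟨T, c, c t₀, h1, h2 _, fun j _ => h2 j, h3⟩
      have hcases : t.1 ≠ t₀.1 ∨ t.2.1 ≠ t₀.2.1 ∨ t.2.2 ≠ t₀.2.2 := by
        by_contra! hcon
        exact hne (Prod.ext hcon.1 (Prod.ext hcon.2.1 hcon.2.2))
      rcases hcases with h1 | h1 | h1
      · refine ⟨(LinearMap.mulLeft ℂ q).comp (LinearMap.mulLeft ℂ p - LinearMap.mulRight ℂ p),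
          fun s => s.1 * zz, fun z hz => ?_, fun s => ?_, ?_⟩
        · exact I.mul_mem_left _ _ (I.sub_mem (I.mul_mem_left _ _ hz) (I.mul_mem_right _ _ hz))
        · obtain ⟨g, hg⟩ := mem_monomialSpan.1 (hy s)
          rw [hg]
          have hc := (comm g s.2.2).1
          generalize weightMonomial e f s.2.2 * aeval h g = b at hc
          simp only [LinearMap.comp_apply, LinearMap.sub_apply, LinearMap.mulLeft_apply,
            LinearMap.mulRight_apply]
          obtain ⟨i, j, k⟩ := s
          have hc' : b * p ^ j * p = p * (b * p ^ j) := by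
            rw [← mul_assoc p, hc.eq, mul_assoc, mul_assoc, ← pow_succ, ← pow_succ']
          simp only
          cases i with
          | zero => simp [hc']
          | succ i =>
            rw [mul_assoc (q ^ (i + 1)), mul_assoc (q ^ (i + 1)) _ p, hc', ← mul_assoc p,
              H.p_mul_q_pow_succ, add_mul, mul_assoc _ p, add_sub_cancel_left, smul_mul_assoc,
              mul_smul_comm, ← mul_assoc q, ← pow_succ']
            push_cast
            rfl
        · simpa [hzz] using h1
      · refine ⟨(LinearMap.mulRight ℂ p).comp (LinearMap.mulRight ℂ q - LinearMap.mulLeft ℂ q),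
          fun s => s.2.1 * zz, fun z hz => ?_, fun s => ?_, ?_⟩
        · exact I.mul_mem_right _ _ (I.sub_mem (I.mul_mem_right _ _ hz) (I.mul_mem_left _ _ hz))
        · obtain ⟨g, hg⟩ := mem_monomialSpan.1 (hy s)
          rw [hg]
          have hc := (comm g s.2.2).2
          generalize weightMonomial e f s.2.2 * aeval h g = b at hc
          simp only [LinearMap.comp_apply, LinearMap.sub_apply, LinearMap.mulLeft_apply,
            LinearMap.mulRight_apply]
          obtain ⟨i, j, k⟩ := s
          have hc' : q * (q ^ i * b) = q ^ i * b * q := by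
            rw [mul_assoc, ← hc.eq, ← mul_assoc, ← mul_assoc, ← pow_succ, ← pow_succ']
          simp only
          cases j with
          | zero => simp [hc']
          | succ j =>
            rw [← mul_assoc q, hc', mul_assoc (q ^ i * b) _ q, H.p_pow_succ_mul_q, mul_add,
              mul_assoc _ q, add_sub_cancel_left, mul_smul_comm, smul_mul_assoc, mul_assoc _ _ p,
              ← pow_succ]
            push_cast
            rfl
        · simpa [hzz] using h1
      · refine ⟨LinearMap.mulLeft ℂ h - LinearMap.mulRight ℂ h, fun s => 2 * s.2.2,
          fun z hz => N.sub_mem (I.mul_mem_left _ _ hz) (I.mul_mem_right _ _ hz), fun s => ?_, ?_⟩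
        · obtain ⟨g, hg⟩ := mem_monomialSpan.1 (hy s)
          rw [hg]
          obtain ⟨i, j, k⟩ := s
          have hh : Commute h (aeval h g) := by
            simpa using (Commute.all X g).map (aeval h)
          have hb : h * (weightMonomial e f k * aeval h g) =
              weightMonomial e f k * aeval h g * h +
                (2 * k : ℂ) • (weightMonomial e f k * aeval h g) := by
            rw [← mul_assoc, H.h_mul_weightMonomial, add_mul, mul_assoc, hh.eq, smul_mul_assoc,
              ← mul_assoc]
          have hp : p ^ j * h = h * p ^ j := ((show Commute p h from H.ph).pow_left j).eq
          have hq : h * q ^ i = q ^ i * h := ((show Commute q h from H.qh).pow_left i).eq.symm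
          simp only [LinearMap.sub_apply, LinearMap.mulLeft_apply, LinearMap.mulRight_apply]
          rw [mul_assoc _ _ h, hp, ← mul_assoc h, ← mul_assoc h, hq, mul_assoc _ h, hb, mul_add,
            add_mul, ← mul_assoc _ h, ← mul_assoc _ _ h, add_sub_cancel_left, mul_smul_comm,
            smul_mul_assoc]
        · simpa using h1
    · rw [Finset.add_sum_erase _ _ ht₀]
      have : ∑ t ∈ y.support, y t = x := hyx
      rw [this]
      exact hx
  obtain ⟨g, hg⟩ := mem_monomialSpan.1 (hy t₀)
  refine ⟨t₀.2.2, g, ?_, ?_⟩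
  · have : y t₀ ∈ I := hmem
    rw [hg] at this
    refine H.mem_of_q_pow_mul_mem hzz I (comm g _).1 t₀.1
      (H.mem_of_mul_p_pow_mem hzz I ?_ t₀.2.1 this)
    exact ((Commute.refl q).pow_right _).mul_right (comm g _).2
  · intro h0
    rw [h0] at hg
    exact Finsupp.mem_support_iff.1 ht₀ (by simp [hg])

/-- Every nonzero two-sided ideal contains a power of `e`. -/
theorem exists_e_pow_mem (H : IsWeylTriple zz μ p q e f h)
    (hgen : Algebra.adjoin ℂ {p, q, e, f, h} = ⊤) (hzz : zz ≠ 0) (I : TwoSidedIdeal R)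
    (hI : I ≠ ⊥) : ∃ n, e ^ n ∈ I := by
  obtain ⟨x, hx, hx0⟩ : ∃ x ∈ I, x ≠ 0 := by
    by_contra! hcon
    exact hI (eq_bot_iff.2 fun x hx => (TwoSidedIdeal.mem_bot R).2 (hcon x hx))
  obtain ⟨k, g, hk, hk0⟩ := H.exists_weight_mem hgen hzz I hx hx0
  have hg0 : g ≠ 0 := by rintro rfl; simp at hk0
  have pos (n : ℕ) (k : ℤ) (g : ℂ[X]) (hg : g ≠ 0) (hn : 0 ≤ k + n)
      (hk : weightMonomial e f k * aeval h g ∈ I) :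
      ∃ (n : ℕ) (g : ℂ[X]), g ≠ 0 ∧ e ^ n * aeval h g ∈ I := by
    induction n generalizing k g with
    | zero =>
      obtain ⟨a, rfl⟩ := Int.eq_ofNat_of_zero_le (by simpa using hn)
      exact ⟨a, g, hg, hk⟩
    | succ n ih =>
      obtain ⟨r, hr0, hr⟩ := H.exists_e_mul_weightMonomial k
      refine ih (k + 1) (r * g) (mul_ne_zero hr0 hg) (by push_cast at hn; omega) ?_
      rw [map_mul, ← mul_assoc, ← hr, mul_assoc]
      exact I.mul_mem_left _ _ hk
  obtain ⟨n, g', hg', hn⟩ := pos k.natAbs k g hg0 (by omega) hk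
  clear hk hk0 hg0 g
  obtain ⟨d, hd⟩ : ∃ d, g'.natDegree < d := ⟨_, Nat.lt_succ_self _⟩
  induction d generalizing n g' with
  | zero => omega
  | succ d ih =>
    set g₁ := g'.comp (X + C 2) - g' with hg₁
    by_cases h0 : g₁ = 0
    · have hroot (m : ℕ) : g'.eval (2 * m : ℂ) = g'.eval 0 := by
        induction m with
        | zero => simp
        | succ m ihm =>
          have := congrArg (eval (2 * m : ℂ)) (sub_eq_zero.1 h0)
          rw [eval_comp, ihm] at this
          rw [← this]
          simp [mul_add]
      have hconst : g' = C (g'.eval 0) := by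
        refine eq_of_infinite_eval_eq _ _ (Set.infinite_of_injective_forall_mem
          (f := fun m : ℕ => (2 * m : ℂ)) (fun a b hab => ?_) fun m => ?_)
        · simpa using hab
        · simpa using hroot m
      rw [hconst, aeval_C, ← Algebra.commutes] at hn
      have hc : g'.eval 0 ≠ 0 := fun hc => hg' (by rw [hconst, hc, C_0])
      refine ⟨n, ?_⟩
      have := I.mul_mem_left (algebraMap ℂ R (g'.eval 0)⁻¹) _ hn
      rwa [← mul_assoc, ← map_mul, inv_mul_cancel₀ hc, map_one, one_mul] at this
    · refine ih (n + 1) g₁ h0 ?_ ?_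
      · have h1 : aeval h g' * e = e * aeval h (g'.comp (X + C 2)) := by
          simpa using H.aeval_mul_e_pow g' 1
        have h2 : e ^ (n + 1) * aeval h g₁ = e ^ n * aeval h g' * e - e * (e ^ n * aeval h g') := by
          rw [mul_assoc, h1, ← mul_assoc, ← mul_assoc, ← pow_succ, ← pow_succ', hg₁, map_sub,
            mul_sub]
        rw [h2]
        exact I.sub_mem (I.mul_mem_right _ _ hn) (I.mul_mem_left _ _ hn)
      · have hdeg : 0 < g'.natDegree := by
          rw [Nat.pos_iff_ne_zero]
          intro hz
          rw [natDegree_eq_zero] at hz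
          obtain ⟨c, hc⟩ := hz
          exact h0 (by rw [hg₁, ← hc]; simp)
        have hX : (X + C 2 : ℂ[X]).natDegree = 1 := natDegree_X_add_C 2
        have hne : g'.comp (X + C 2) ≠ 0 := fun hz => hg' (by
          rwa [← taylor_apply, map_eq_zero_iff _ (taylor_injective (2 : ℂ))] at hz)
        have : g₁.natDegree < (g'.comp (X + C 2)).natDegree := by
          refine natDegree_lt_natDegree h0 (degree_sub_lt_left ?_ hne ?_)
          · rw [degree_eq_natDegree hne, degree_eq_natDegree hg', natDegree_comp, hX, mul_one]
          · rw [leadingCoeff_comp (by rw [hX]; exact one_ne_zero)]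
            simp
        rw [natDegree_comp, hX, mul_one] at this
        omega

theorem e_pow_mem_of_succ (H : IsWeylTriple zz μ p q e f h) (I : TwoSidedIdeal R) {n : ℕ}
    (h₁ : μ ≠ n) (h₂ : μ ≠ -n - 2) (hn : e ^ (n + 1) ∈ I) : e ^ n ∈ I := by
  have hf : e ^ (n + 1) * f = f * e ^ (n + 1) + ((n + 1 : ℂ)) • (e ^ n * (h + (n : ℂ) • 1)) := by
    clear hn h₁ h₂
    induction n with
    | zero => simpa using H.ef
    | succ n ih =>
      have hh : h * e ^ (n + 1) = e ^ (n + 1) * h + (2 * (n + 1 : ℕ) : ℂ) • e ^ (n + 1) :=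
        H.h_mul_weightMonomial (Int.ofNat (n + 1))
      rw [pow_succ' e (n + 1), mul_assoc, ih, mul_add, ← mul_assoc, H.ef, mul_smul_comm,
        ← mul_assoc e, ← pow_succ', add_mul, hh, mul_assoc]
      simp only [mul_add, mul_smul_comm, mul_one]
      push_cast
      module
  have m1 : e ^ n * (h + (n : ℂ) • 1) ∈ I := by
    have := I.sub_mem (I.mul_mem_right _ f hn) (I.mul_mem_left f _ hn)
    rw [hf, add_sub_cancel_left] at this
    have := I.mul_mem_left (algebraMap ℂ R (n + 1 : ℂ)⁻¹) _ this
    rwa [← Algebra.smul_def, inv_smul_smul₀ (by exact_mod_cast n.succ_ne_zero)] at this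
  have m2 : f * e ^ (n + 1) ∈ I := I.mul_mem_left f _ hn
  have hfe : f * e ^ (n + 1) = e ^ n * ((1 / 4 * (μ - n) * (μ + n + 2) : ℂ) • 1) -
      e ^ n * (h + (n : ℂ) • 1) * ((1 / 4 : ℂ) • (h + (3 * n + 2 : ℂ) • 1)) := by
    have := H.aeval_mul_e_pow (fePoly μ) n
    rw [← H.fe_eq, mul_assoc, ← pow_succ'] at this
    rw [this, mul_assoc (e ^ n) (h + _), ← mul_sub]
    congr 1
    have : aeval h ((fePoly μ).comp (X + C (2 * n : ℂ))) = (1 / 4 : ℂ) •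
        ((μ ^ 2 + 2 * μ) • (1 : R) - (h + (2 * n : ℂ) • 1) * (h + (2 * n : ℂ) • 1) -
          (2 : ℂ) • (h + (2 * n : ℂ) • 1)) := by
      simp [fePoly, Algebra.smul_def, map_ofNat]
    rw [this]
    simp only [smul_mul_assoc, one_mul, mul_smul_comm, mul_one, mul_add, add_mul]
    module
  rw [hfe] at m2
  have m3 := I.add_mem m2 (I.mul_mem_right _ ((1 / 4 : ℂ) • (h + (3 * n + 2 : ℂ) • 1)) m1)
  rw [sub_add_cancel, mul_smul_comm, mul_one] at m3
  have m4 := I.mul_mem_left (algebraMap ℂ R (1 / 4 * (μ - n) * (μ + n + 2))⁻¹) _ m3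
  rwa [← Algebra.smul_def, inv_smul_smul₀] at m4
  have h3 : μ + n + 2 ≠ 0 := fun h3 => h₂ (by linear_combination h3)
  exact mul_ne_zero (mul_ne_zero (by norm_num) (sub_ne_zero.2 h₁)) h3

section Module

variable {M : Type*} [AddCommGroup M] [Module ℂ M] [Module R M] [IsScalarTower ℂ R M]

theorem h_smul_f_pow_smul (H : IsWeylTriple zz μ p q e f h) {ν : ℂ} {w : M} (hw : h • w = ν • w)
    (k : ℕ) : h • f ^ k • w = (ν - 2 * k) • f ^ k • w := by
  induction k with
  | zero => simpa using hw
  | succ k ih =>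
    rw [pow_succ', mul_smul, ← mul_smul h, H.hf, sub_smul, mul_smul, ih, smul_assoc,
      smul_complex_smul f, ← mul_smul f, ← pow_succ']
    generalize f ^ (k + 1) • w = y
    push_cast
    module

theorem e_smul_f_pow_succ_smul (H : IsWeylTriple zz μ p q e f h) {ν : ℂ} {w : M}
    (he : e • w = 0) (hw : h • w = ν • w) (k : ℕ) :
    e • f ^ (k + 1) • w = ((k + 1) * (ν - k)) • f ^ k • w := by
  induction k with
  | zero => rw [zero_add, pow_one, ← mul_smul, H.ef, add_smul, mul_smul, he, hw]; simp
  | succ k ih =>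
    rw [pow_succ' f (k + 1), mul_smul, ← mul_smul e, H.ef, add_smul, mul_smul, ih,
      H.h_smul_f_pow_smul hw, smul_complex_smul f, ← mul_smul f, ← pow_succ']
    generalize f ^ (k + 1) • w = y
    push_cast
    module

theorem e_pow_smul_f_pow_smul (H : IsWeylTriple zz μ p q e f h) {ν : ℂ} {w : M}
    (he : e • w = 0) (hw : h • w = ν • w) (k : ℕ) :
    e ^ k • f ^ k • w = (∏ i ∈ Finset.range k, ((i + 1) * (ν - i) : ℂ)) • w := by
  induction k with
  | zero => simp
  | succ k ih =>
    rw [pow_succ e, mul_smul, H.e_smul_f_pow_succ_smul he hw, smul_complex_smul (e ^ k), ih,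
      Finset.prod_range_succ, smul_smul, mul_comm]

theorem e_pow_smul_f_pow_smul_ne_zero (H : IsWeylTriple zz μ p q e f h) {ν : ℂ} {w : M}
    (he : e • w = 0) (hw : h • w = ν • w) (hν : ∀ i : ℕ, ν ≠ i) (hw0 : w ≠ 0) (k : ℕ) :
    e ^ k • f ^ k • w ≠ 0 := by
  rw [H.e_pow_smul_f_pow_smul he hw]
  refine smul_ne_zero (Finset.prod_ne_zero_iff.2 fun i _ => mul_ne_zero ?_ (sub_ne_zero.2 (hν i)))
    hw0
  exact_mod_cast i.succ_ne_zero

end Module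

theorem h_mul_of_e_mul_eq_zero {m : ℕ} (H : IsWeylTriple zz m p q e f h)
    (he : e ^ (m + 1) = 0) {x : R} (hx : e * x = 0) : h * x = (m : ℂ) • x := by
  by_contra hne
  have hcas : h * (h * x) = (m ^ 2 + 2 * m : ℂ) • x - (2 : ℂ) • (h * x) := by
    have h0 : f * e * x = 0 := by rw [mul_assoc, hx, mul_zero]
    rw [H.cas, smul_mul_assoc, smul_eq_zero_iff_right (by norm_num)] at h0
    simp only [sub_mul, smul_mul_assoc, one_mul, mul_assoc] at h0
    rw [sub_sub, sub_eq_zero] at h0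
    rw [h0, add_sub_cancel_right]
  have he' : e * h = h * e - (2 : ℂ) • e := by rw [H.he]; abel
  refine H.e_pow_smul_f_pow_smul_ne_zero (ν := -m - 2) (w := h * x - (m : ℂ) • x) ?_ ?_ ?_
    (sub_ne_zero.2 hne) (m + 1) (by rw [he, zero_smul])
  · rw [smul_eq_mul, mul_sub, ← mul_assoc, he', sub_mul, mul_assoc, mul_smul_comm, smul_mul_assoc,
      hx]
    simp
  · rw [smul_eq_mul, mul_sub, mul_smul_comm, hcas]
    module
  · intro i hi
    have : (m + 2 + i : ℂ) = 0 := by linear_combination -hi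
    exact absurd this (by exact_mod_cast (by omega : m + 2 + i ≠ 0))

open MulOpposite in
theorem op (H : IsWeylTriple zz μ p q e f h) :
    IsWeylTriple (-zz) μ (op p) (op q) (op e) (op f) (op (-h)) where
  pq := unop_injective (by simp [H.pq])
  pe := unop_injective (by simp [H.pe])
  pf := unop_injective (by simp [H.pf])
  ph := unop_injective (by simp [H.ph])
  qe := unop_injective (by simp [H.qe])
  qf := unop_injective (by simp [H.qf])
  qh := unop_injective (by simp [H.qh])
  he := unop_injective (by simp [H.he])
  hf := unop_injective (by simp [H.hf])
  ef := unop_injective (by simp [H.ef])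
  cas := unop_injective (by
    simp only [unop_mul, unop_smul, unop_sub, unop_op, unop_one]
    rw [H.ef, H.cas]
    simp only [mul_neg, neg_mul, neg_neg]
    module)

theorem mul_h_of_mul_e_eq_zero {m : ℕ} (H : IsWeylTriple zz m p q e f h)
    (he : e ^ (m + 1) = 0) {x : R} (hx : x * e = 0) : x * h = -((m : ℂ) • x) := by
  have := H.op.h_mul_of_e_mul_eq_zero (x := MulOpposite.op x)
    (MulOpposite.unop_injective (by simpa using he))
    (MulOpposite.unop_injective (by simpa using hx))
  have := congrArg MulOpposite.unop this
  simp only [MulOpposite.unop_mul, MulOpposite.unop_op, MulOpposite.unop_smul, mul_neg] at this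
  rw [← this, neg_neg]

theorem aeval_mul_of_eigen {y : R} {c : ℂ} (hy : h * y = c • y) (g : ℂ[X]) :
    aeval h g * y = g.eval c • y := by
  induction g using Polynomial.induction_on with
  | C a => simp [Algebra.smul_def]
  | add a b ha hb => simp only [map_add, add_mul, eval_add, add_smul, ha, hb]
  | monomial n a ih =>
    rw [pow_succ, ← mul_assoc, map_mul, mul_assoc, aeval_X, hy, mul_smul_comm, ih, smul_smul]
    congr 1
    simp only [eval_mul, eval_C, eval_pow, eval_X]
    ring

/-- If `e ^ (m + 1) = 0` and `μ = m`, every nonzero two-sided ideal contains `e ^ m`. -/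
theorem e_pow_mem_of_ne_bot {m : ℕ} (H : IsWeylTriple zz m p q e f h)
    (hgen : Algebra.adjoin ℂ {p, q, e, f, h} = ⊤) (hzz : zz ≠ 0) (he : e ^ (m + 1) = 0)
    (I : TwoSidedIdeal R) (hI : I ≠ ⊥) : e ^ m ∈ I := by
  obtain ⟨x, hx, hx0⟩ : ∃ x ∈ I, x ≠ 0 := by
    by_contra! hcon
    exact hI (eq_bot_iff.2 fun x hx => (TwoSidedIdeal.mem_bot R).2 (hcon x hx))
  obtain ⟨k, g, hk, hk0⟩ := H.exists_weight_mem hgen hzz I hx hx0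
  clear hx hx0 x
  obtain ⟨n, hn⟩ : ∃ n : ℕ, (m : ℤ) < k + n := ⟨(m + 1 - k).natAbs, by omega⟩
  induction n generalizing k g with
  | zero =>
    refine absurd ?_ hk0
    obtain ⟨a, rfl⟩ : ∃ a : ℕ, k = Int.ofNat (m + 1 + a) := ⟨(k - (m + 1)).toNat, by
      simp only [Int.ofNat_eq_natCast]; omega⟩
    rw [weightMonomial, pow_add, he, zero_mul, zero_mul]
  | succ n ih =>
    obtain ⟨r, -, hr⟩ := H.exists_e_mul_weightMonomial k
    obtain ⟨r', hr'⟩ := H.exists_weightMonomial_mul_e k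
    have hl : e * (weightMonomial e f k * aeval h g) =
        weightMonomial e f (k + 1) * aeval h (r * g) := by
      rw [map_mul, ← mul_assoc, ← mul_assoc, hr]
    have hrt : weightMonomial e f k * aeval h g * e =
        weightMonomial e f (k + 1) * aeval h (r' * g.comp (X + C 2)) := by
      have h1 : aeval h g * e = e * aeval h (g.comp (X + C 2)) := by
        simpa using H.aeval_mul_e_pow g 1
      rw [mul_assoc, h1, map_mul, ← mul_assoc, ← mul_assoc, hr']
    have hkn : (m : ℤ) < k + 1 + n := by push_cast at hn; omega
    by_cases hl0 : e * (weightMonomial e f k * aeval h g) = 0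
    · by_cases hr0 : weightMonomial e f k * aeval h g * e = 0
      · have h1 := H.h_mul_of_e_mul_eq_zero he hl0
        have h2 := H.mul_h_of_mul_e_eq_zero he hr0
        have hcomm : Commute h (aeval h g) := by simpa using (Commute.all X g).map (aeval h)
        rw [← mul_assoc, H.h_mul_weightMonomial, add_mul, mul_assoc, hcomm.eq, smul_mul_assoc,
          ← mul_assoc, h2, neg_add_eq_iff_eq_add, ← add_smul] at h1
        have hkm : k = m := by
          have h3 : (2 * k : ℂ) = m + m := smul_left_injective ℂ hk0 h1
          have h4 : (k : ℂ) = (m : ℤ) := by push_cast; linear_combination h3 / 2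
          exact_mod_cast h4
        subst hkm
        have hem : h * e ^ m = (m : ℂ) • e ^ m :=
          H.h_mul_of_e_mul_eq_zero he (by rw [← pow_succ', he])
        have hx : weightMonomial e f m * aeval h g =
            (g.comp (X - C (2 * m : ℂ))).eval (m : ℂ) • e ^ m := by
          rw [← aeval_mul_of_eigen hem, H.aeval_mul_e_pow, comp_assoc]
          simp [weightMonomial]
        rw [hx] at hk hk0
        have := I.mul_mem_left (algebraMap ℂ R ((g.comp (X - C (2 * m : ℂ))).eval (m : ℂ))⁻¹) _ hk
        rwa [← Algebra.smul_def, inv_smul_smul₀] at this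
        rintro h0
        rw [h0, zero_smul] at hk0
        exact hk0 rfl
      · exact ih (k + 1) _ (hrt ▸ I.mul_mem_right _ e hk) (hrt ▸ hr0) hkn
    · exact ih (k + 1) _ (hl ▸ I.mul_mem_left e _ hk) (hl ▸ hl0) hkn

theorem eq_top_of_e_pow_mem (H : IsWeylTriple zz μ p q e f h) (I : TwoSidedIdeal R) {n : ℕ}
    (hμ : ∀ i < n, μ ≠ i ∧ μ ≠ -i - 2) (hn : e ^ n ∈ I) : I = ⊤ := by
  induction n with
  | zero => exact I.one_mem_iff.1 (by simpa using hn)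
  | succ n ih =>
    exact ih (fun i hi => hμ i (by omega))
      (H.e_pow_mem_of_succ I (hμ n (by omega)).1 (hμ n (by omega)).2 hn)

/-- For `μ = m` a natural number, there is at most one two-sided ideal besides `⊥` and `⊤`. -/
theorem eq_of_ne_bot_of_ne_top {m : ℕ} (H : IsWeylTriple zz m p q e f h)
    (hgen : Algebra.adjoin ℂ {p, q, e, f, h} = ⊤) (hzz : zz ≠ 0) {I K : TwoSidedIdeal R}
    (hI : I ≠ ⊥) (hI' : I ≠ ⊤) (hK : K ≠ ⊥) (hK' : K ≠ ⊤) : I = K := by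
  have hμ₁ (i : ℕ) : (m : ℂ) ≠ -i - 2 := fun hi => by
    have : (m + i + 2 : ℂ) = 0 := by linear_combination hi
    exact absurd this (by exact_mod_cast (by omega : m + i + 2 ≠ 0))
  have hlow (L : TwoSidedIdeal R) (hL : e ^ m ∈ L) : L = ⊤ :=
    H.eq_top_of_e_pow_mem L (fun i hi => ⟨by exact_mod_cast hi.ne', hμ₁ i⟩) hL
  have hmem (L : TwoSidedIdeal R) (hL : L ≠ ⊥) : e ^ (m + 1) ∈ L := by
    obtain ⟨n, hn⟩ := H.exists_e_pow_mem hgen hzz L hL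
    rcases le_or_gt n (m + 1) with hnm | hnm
    · obtain ⟨a, ha⟩ := Nat.exists_eq_add_of_le hnm
      rw [ha, pow_add]
      exact L.mul_mem_right _ _ hn
    · obtain ⟨a, rfl⟩ := Nat.exists_eq_add_of_le hnm.le
      clear hnm
      induction a with
      | zero => exact hn
      | succ a ih =>
        exact ih (H.e_pow_mem_of_succ L (by exact_mod_cast (by omega : m ≠ m + 1 + a)) (hμ₁ _) hn)
  have key (J L : TwoSidedIdeal R) (hJ : e ^ (m + 1) ∈ J) (hJL : J ≤ L) (hL : L ≠ ⊤) : J = L := by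
    by_contra hne
    let π : R →ₐ[ℂ] J.ringCon.Quotient := J.ringCon.mkₐ ℂ
    have hπ (x : R) : π x = 0 ↔ x ∈ J := by
      rw [← TwoSidedIdeal.mem_ker]
      change x ∈ TwoSidedIdeal.ker J.ringCon.mk' ↔ _
      rw [J.ker_ringCon_mk']
    have hsurj : Function.Surjective π := J.ringCon.mk'_surjective
    have hgen' : Algebra.adjoin ℂ {π p, π q, π e, π f, π h} = ⊤ := by
      have := congrArg (Subalgebra.map π) hgen
      rw [AlgHom.map_adjoin, Algebra.map_top, (AlgHom.range_eq_top π).2 hsurj] at this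
      simpa [Set.image_insert_eq] using this
    let ψ : J.ringCon.Quotient →+* L.ringCon.Quotient := RingCon.lift _ L.ringCon.mk' (by
      intro x y hxy
      exact (RingCon.eq _).2 (TwoSidedIdeal.ringCon_le_iff.1 hJL hxy))
    have hψ (x : R) : ψ (π x) = 0 ↔ x ∈ L := by
      conv_rhs => rw [← L.ker_ringCon_mk', TwoSidedIdeal.mem_ker]
      rfl
    have hne' : TwoSidedIdeal.ker ψ ≠ ⊥ := by
      intro h0
      refine hne (le_antisymm hJL fun x hx => ?_)
      have : π x ∈ TwoSidedIdeal.ker ψ := (TwoSidedIdeal.mem_ker _).2 ((hψ x).2 hx)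
      rw [h0, TwoSidedIdeal.mem_bot] at this
      exact (hπ x).1 this
    have := (H.map π).e_pow_mem_of_ne_bot hgen' hzz (by rw [← map_pow]; exact (hπ _).2 hJ) _ hne'
    rw [TwoSidedIdeal.mem_ker, ← map_pow] at this
    exact hL (hlow L ((hψ _).1 this))
  have h1 : e ^ (m + 1) ∈ I ⊓ K := (TwoSidedIdeal.mem_inf R).2 ⟨hmem I hI, hmem K hK⟩
  exact (key _ I h1 inf_le_left hI').symm.trans (key _ K h1 inf_le_right hK')

end Algebra

end IsWeylTriple

/-- A highest weight vector of weight `ν` for a Weyl triple acting on a module. -/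
structure IsHighestWeight {R M : Type*} [Ring R] [AddCommGroup M] [Module ℂ M] [Module R M]
    (p e h : R) (ν : ℂ) (w : M) : Prop where
  e_smul : e • w = 0
  p_smul : p • w = 0
  h_smul : h • w = ν • w

namespace IsWeylTriple

variable {R : Type*} [Ring R] [Algebra ℂ R] {zz μ ν : ℂ} {p q e f h : R}
  {M : Type*} [AddCommGroup M] [Module ℂ M] [Module R M] [IsScalarTower ℂ R M] {w : M}

theorem p_smul_monomial_smul (H : IsWeylTriple zz μ p q e f h)
    (hw : IsHighestWeight p e h ν w) (i j : ℕ) :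
    p • q ^ (j + 1) • f ^ i • w = ((j + 1) * zz : ℂ) • q ^ j • f ^ i • w := by
  have hp : p • f ^ i • w = 0 := by
    rw [← mul_smul, ((show Commute p f from H.pf).pow_right i).eq, mul_smul, hw.p_smul, smul_zero]
  rw [← mul_smul, H.p_mul_q_pow_succ, add_smul, mul_smul, hp, smul_zero, zero_add, smul_assoc]

theorem qp_smul_monomial_smul (H : IsWeylTriple zz μ p q e f h)
    (hw : IsHighestWeight p e h ν w) (i j : ℕ) :
    (q * p) • q ^ j • f ^ i • w = (j * zz : ℂ) • q ^ j • f ^ i • w := by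
  cases j with
  | zero =>
    rw [mul_smul, pow_zero, one_smul, ← mul_smul p,
      ((show Commute p f from H.pf).pow_right i).eq, mul_smul, hw.p_smul]
    simp
  | succ j =>
    rw [mul_smul, H.p_smul_monomial_smul hw, smul_complex_smul, ← mul_smul, ← pow_succ',
      Nat.cast_succ]

theorem h_smul_monomial_smul (H : IsWeylTriple zz μ p q e f h)
    (hw : IsHighestWeight p e h ν w) (i j : ℕ) :
    h • q ^ j • f ^ i • w = (ν - 2 * i) • q ^ j • f ^ i • w := by
  rw [← mul_smul, ← ((show Commute q h from H.qh).pow_left j).eq, mul_smul,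
    H.h_smul_f_pow_smul hw.h_smul, smul_complex_smul]

theorem smul_mem_span_monomials (H : IsWeylTriple zz μ p q e f h)
    (hgen : Algebra.adjoin ℂ {p, q, e, f, h} = ⊤) (hw : IsHighestWeight p e h ν w) (r : R) :
    r • w ∈ Submodule.span ℂ (Set.range fun s : ℕ × ℕ => q ^ s.2 • f ^ s.1 • w) := by
  set W := Submodule.span ℂ (Set.range fun s : ℕ × ℕ => q ^ s.2 • f ^ s.1 • w)
  have hmem (i j : ℕ) : q ^ j • f ^ i • w ∈ W := Submodule.subset_span ⟨(i, j), rfl⟩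
  refine smul_mem_of_adjoin_eq_top hgen W (fun s hs x hx => ?_) r (by simpa using hmem 0 0)
  suffices ∀ i j : ℕ, s • q ^ j • f ^ i • w ∈ W by
    induction hx using Submodule.span_induction with
    | mem x hx => obtain ⟨t, rfl⟩ := hx; exact this _ _
    | zero => rw [smul_zero]; exact W.zero_mem
    | add x y _ _ hx hy => rw [smul_add]; exact W.add_mem hx hy
    | smul c x _ hx => rw [smul_complex_smul]; exact W.smul_mem c hx
  intro i j
  rcases hs with rfl | rfl | rfl | rfl | rfl
  · cases j with
    | zero =>
      rw [pow_zero, one_smul, ← mul_smul, ((show Commute s f from H.pf).pow_right i).eq, mul_smul,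
        hw.p_smul, smul_zero]
      exact W.zero_mem
    | succ j => rw [H.p_smul_monomial_smul hw]; exact W.smul_mem _ (hmem i j)
  · rw [← mul_smul, ← pow_succ']; exact hmem i (j + 1)
  · rw [← mul_smul, ← ((show Commute q s from H.qe).pow_left j).eq, mul_smul]
    cases i with
    | zero => simp [hw.e_smul]
    | succ i =>
      rw [H.e_smul_f_pow_succ_smul hw.e_smul hw.h_smul, smul_complex_smul]
      exact W.smul_mem _ (hmem i j)
  · rw [← mul_smul, ← ((show Commute q s from H.qf).pow_left j).eq, mul_smul, ← mul_smul s,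
      ← pow_succ']
    exact hmem (i + 1) j
  · rw [H.h_smul_monomial_smul hw]; exact W.smul_mem _ (hmem i j)

/-- A submodule contains the leading terms of its elements. -/
theorem coeff_zero_smul_mem (H : IsWeylTriple zz μ p q e f h) (hzz : zz ≠ 0)
    (hw : IsHighestWeight p e h ν w) (N : Submodule R M) (c : ℕ × ℕ →₀ ℂ)
    (hc : (c.sum fun s a => a • q ^ s.2 • f ^ s.1 • w) ∈ N) : c 0 • w ∈ N := by
  classical
  refine eigencomponent_mem (N.restrictScalars ℂ) (c.support.erase 0)
    (fun s => c s • q ^ s.2 • f ^ s.1 • w) (c 0 • w) (fun s hs => ?_) ?_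
  · have hne : s ≠ 0 := Finset.ne_of_mem_erase hs
    have hcases : s.1 ≠ 0 ∨ s.2 ≠ 0 := by
      by_contra! hcon
      exact hne (Prod.ext hcon.1 hcon.2)
    rcases hcases with h1 | h1
    · refine ⟨Algebra.lsmul ℂ ℂ M h, fun s => ν - 2 * s.1, ν, fun y hy => N.smul_mem h hy,
        ?_, fun t _ => ?_, ?_⟩
      · simp only [Algebra.lsmul_coe]
        rw [smul_complex_smul, hw.h_smul, smul_comm]
      · simp only [Algebra.lsmul_coe]
        rw [smul_complex_smul, H.h_smul_monomial_smul hw, smul_comm]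
      · simpa using h1
    · refine ⟨Algebra.lsmul ℂ ℂ M (q * p), fun s => s.2 * zz, 0, fun y hy => N.smul_mem _ hy,
        ?_, fun t _ => ?_, ?_⟩
      · simp only [Algebra.lsmul_coe]
        rw [smul_complex_smul, mul_smul, hw.p_smul]
        simp
      · simp only [Algebra.lsmul_coe]
        rw [smul_complex_smul, H.qp_smul_monomial_smul hw, smul_comm]
      · simpa [hzz] using h1
  · have : (c.sum fun s a => a • q ^ s.2 • f ^ s.1 • w) =
        c 0 • w + ∑ s ∈ c.support.erase 0, c s • q ^ s.2 • f ^ s.1 • w := by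
      rw [Finsupp.sum]
      by_cases h0 : (0 : ℕ × ℕ) ∈ c.support
      · rw [← Finset.add_sum_erase _ _ h0]
        simp
      · rw [Finset.erase_eq_of_notMem h0, Finsupp.notMem_support_iff.1 h0, zero_smul, zero_add]
    rw [← this]
    exact hc

/-- In a cyclic highest weight module, the sum of all proper submodules is proper. -/
theorem sSup_ne_top (H : IsWeylTriple zz μ p q e f h)
    (hgen : Algebra.adjoin ℂ {p, q, e, f, h} = ⊤) (hzz : zz ≠ 0)
    (hw : IsHighestWeight p e h ν w) (hcyc : ∀ x : M, ∃ r : R, r • w = x) (hw0 : w ≠ 0) :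
    sSup {N : Submodule R M | N ≠ ⊤} ≠ ⊤ := by
  intro htop
  have hexp (x : M) : ∃ c : ℕ × ℕ →₀ ℂ, (c.sum fun s a => a • q ^ s.2 • f ^ s.1 • w) = x := by
    obtain ⟨r, rfl⟩ := hcyc x
    exact Finsupp.mem_span_range_iff_exists_finsupp.1 (H.smul_mem_span_monomials hgen hw r)
  let Low : AddSubgroup M :=
    { carrier := {x | ∃ c : ℕ × ℕ →₀ ℂ, c 0 = 0 ∧
        (c.sum fun s a => a • q ^ s.2 • f ^ s.1 • w) = x}
      zero_mem' := ⟨0, by simp⟩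
      add_mem' := by
        rintro _ _ ⟨c, hc, rfl⟩ ⟨d, hd, rfl⟩
        exact ⟨c + d, by simp [hc, hd], Finsupp.sum_add_index' (by simp) (by simp [add_smul])⟩
      neg_mem' := by
        rintro _ ⟨c, hc, rfl⟩
        exact ⟨-c, by simp [hc], by rw [Finsupp.sum_neg_index (by simp)]; simp [Finsupp.sum]⟩ }
  have hLow (N : Submodule R M) (hN : N ≠ ⊤) : ∀ x ∈ N, x ∈ Low := by
    intro x hx
    obtain ⟨c, rfl⟩ := hexp x
    refine ⟨c, ?_, rfl⟩
    by_contra hc0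
    have h1 : c 0 • w ∈ N := H.coeff_zero_smul_mem hzz hw N c hx
    have h2 : w ∈ N := ((N.restrictScalars ℂ).smul_mem_iff hc0).1 h1
    refine hN (eq_top_iff.2 fun y _ => ?_)
    obtain ⟨r, rfl⟩ := hcyc y
    exact N.smul_mem r h2
  have hwLow : w ∈ Low := by
    have : w ∈ sSup {N : Submodule R M | N ≠ ⊤} := by
      rw [htop]; exact Submodule.mem_top
    rw [sSup_eq_iSup'] at this
    exact Submodule.iSup_induction _ (motive := (· ∈ Low)) this
      (fun N x hx => hLow N.1 N.2 x hx) Low.zero_mem (fun _ _ => Low.add_mem)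
  obtain ⟨c, hc, hcw⟩ := hwLow
  have := H.coeff_zero_smul_mem hzz hw ⊥ (c - Finsupp.single 0 1) (by
    rw [Finsupp.sum_sub_index (by simp [sub_smul]), hcw]
    simp)
  simp [hc, hw0] at this

theorem f_pow_smul_eq_zero {m : ℕ} (H : IsWeylTriple zz μ p q e f h)
    (hgen : Algebra.adjoin ℂ {p, q, e, f, h} = ⊤) [IsSimpleModule R M]
    (hw : IsHighestWeight p e h (m : ℂ) w) : f ^ (m + 1) • w = 0 := by
  by_contra hne
  have hy : IsHighestWeight p e h (m - 2 * (m + 1 : ℕ) : ℂ) (f ^ (m + 1) • w) :=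
    { e_smul := by rw [H.e_smul_f_pow_succ_smul hw.e_smul hw.h_smul]; simp
      p_smul := by
        rw [← mul_smul, ((show Commute p f from H.pf).pow_right _).eq, mul_smul, hw.p_smul,
          smul_zero]
      h_smul := H.h_smul_f_pow_smul hw.h_smul _ }
  obtain ⟨r, hr⟩ := IsSimpleModule.toSpanSingleton_surjective R hne w
  have hmem := H.smul_mem_span_monomials hgen hy r
  rw [LinearMap.toSpanSingleton_apply] at hr
  rw [hr] at hmem
  obtain ⟨c, hc⟩ := Finsupp.mem_span_range_iff_exists_finsupp.1 hmem
  have : -w ∈ (⊥ : Submodule ℂ M) := by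
    refine eigencomponent_mem ⊥ c.support (fun s => c s • q ^ s.2 • f ^ s.1 • f ^ (m + 1) • w)
      (-w) (fun s _ => ⟨Algebra.lsmul ℂ ℂ M h, fun s => m - 2 * (m + 1 : ℕ) - 2 * s.1, m,
        by simp, ?_, fun t _ => ?_, fun h0 => ?_⟩) ?_
    · simp [hw.h_smul]
    · simp only [Algebra.lsmul_coe]
      rw [smul_complex_smul, H.h_smul_monomial_smul hy, smul_comm]
    · have : (2 * (m + 1 : ℕ) + 2 * s.1 : ℂ) = 0 := by linear_combination -h0
      exact absurd this (by exact_mod_cast (by omega : 2 * (m + 1) + 2 * s.1 ≠ 0))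
    · rw [Submodule.mem_bot, neg_add_eq_zero]
      exact hc.symm
  rw [Submodule.mem_bot, neg_eq_zero] at this
  exact hne (by rw [this, smul_zero])

/-- On a simple highest weight module of integral dominant highest weight `m`, the element
`e ^ (m + 1)` vanishes. -/
theorem e_pow_smul_eq_zero {m : ℕ} (H : IsWeylTriple zz μ p q e f h)
    (hgen : Algebra.adjoin ℂ {p, q, e, f, h} = ⊤) [IsSimpleModule R M]
    (hw : IsHighestWeight p e h (m : ℂ) w) (hw0 : w ≠ 0) (x : M) : e ^ (m + 1) • x = 0 := by
  obtain ⟨r, rfl⟩ := IsSimpleModule.toSpanSingleton_surjective R hw0 x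
  rw [LinearMap.toSpanSingleton_apply]
  have hmem := H.smul_mem_span_monomials hgen hw r
  generalize r • w = y at hmem
  have hf := H.f_pow_smul_eq_zero hgen hw
  induction hmem using Submodule.span_induction with
  | mem y hy =>
    obtain ⟨⟨i, j⟩, rfl⟩ := hy
    have hq : e ^ (m + 1) * q ^ j = q ^ j * e ^ (m + 1) :=
      ((show Commute q e from H.qe).pow_pow j (m + 1)).eq.symm
    simp only
    rw [← mul_smul, hq, mul_smul]
    rcases lt_or_ge i (m + 1) with hi | hi
    · obtain ⟨a, ha⟩ := Nat.exists_eq_add_of_lt hi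
      rw [ha, show i + a + 1 = a + 1 + i by omega, pow_add, mul_smul,
        H.e_pow_smul_f_pow_smul hw.e_smul hw.h_smul, smul_complex_smul, pow_succ, mul_smul,
        hw.e_smul]
      simp
    · obtain ⟨a, rfl⟩ := Nat.exists_eq_add_of_le hi
      rw [add_comm (m + 1) a, pow_add f, mul_smul (f ^ a), hf]
      simp
  | zero => simp
  | add y z _ _ hy hz => rw [smul_add, hy, hz, add_zero]
  | smul c y _ hy => rw [smul_complex_smul, hy, smul_zero]

end IsWeylTriple

end

/-- Elements of an algebra satisfying the defining relations of the Schrödinger algebra. -/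
structure IsSchrodingerTuple {R : Type*} [Ring R] [Algebra ℂ R] (e h f p q z : R) : Prop where
  he : h * e = e * h + (2 : ℂ) • e
  ef : e * f = f * e + h
  hf : h * f = f * h - (2 : ℂ) • f
  eq : e * q = q * e + p
  ep : e * p = p * e
  hp : h * p = p * h + p
  fp : f * p = p * f + q
  fq : f * q = q * f
  hq : h * q = q * h - q
  pq : p * q = q * p + z
  ze : z * e = e * z
  zh : z * h = h * z
  zf : z * f = f * z
  zp : z * p = p * z
  zq : z * q = q * z

/-- The cubic Casimir element. -/
noncomputable def casimir {R : Type*} [Ring R] [Algebra ℂ R] (e h f p q z : R) : R :=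
  (h * h + h + (4 : ℂ) • (f * e)) * z - (2 : ℂ) • (f * (p * p) - e * (q * q) - h * (p * q))

theorem mul_mul_of_eq {R : Type*} [Ring R] {a b y : R} (hab : a * b = y) (x : R) :
    a * (b * x) = y * x := by
  rw [← mul_assoc, hab]

namespace IsSchrodingerTuple

variable {R : Type*} [Ring R] [Algebra ℂ R] {e h f p q z : R}

theorem map {S : Type*} [Ring S] [Algebra ℂ S] (H : IsSchrodingerTuple e h f p q z)
    (φ : R →ₐ[ℂ] S) : IsSchrodingerTuple (φ e) (φ h) (φ f) (φ p) (φ q) (φ z) where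
  he := by rw [← map_mul, H.he]; simp
  ef := by rw [← map_mul, H.ef]; simp
  hf := by rw [← map_mul, H.hf]; simp
  eq := by rw [← map_mul, H.eq]; simp
  ep := by rw [← map_mul, H.ep]; simp
  hp := by rw [← map_mul, H.hp]; simp
  fp := by rw [← map_mul, H.fp]; simp
  fq := by rw [← map_mul, H.fq]; simp
  hq := by rw [← map_mul, H.hq]; simp
  pq := by rw [← map_mul, H.pq]; simp
  ze := by rw [← map_mul, H.ze]; simp
  zh := by rw [← map_mul, H.zh]; simp
  zf := by rw [← map_mul, H.zf]; simp
  zp := by rw [← map_mul, H.zp]; simp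
  zq := by rw [← map_mul, H.zq]; simp

theorem casimir_mul_comm (H : IsSchrodingerTuple e h f p q z) {x : R}
    (hx : x ∈ ({e, h, f, p, q, z} : Set R)) :
    casimir e h f p q z * x = x * casimir e h f p q z := by
  rcases hx with rfl | rfl | rfl | rfl | rfl | rfl <;>
  · simp only [casimir, mul_assoc, add_mul, mul_add, sub_mul, mul_sub, smul_mul_assoc,
      mul_smul_comm, smul_add, smul_sub, smul_smul, H.he, H.ef, H.hf, H.eq, H.ep, H.hp, H.fp, H.fq,
      H.hq, H.pq, H.ze, H.zh, H.zf, H.zp, H.zq, mul_mul_of_eq H.he, mul_mul_of_eq H.ef,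
      mul_mul_of_eq H.hf, mul_mul_of_eq H.eq, mul_mul_of_eq H.ep, mul_mul_of_eq H.hp,
      mul_mul_of_eq H.fp, mul_mul_of_eq H.fq, mul_mul_of_eq H.hq, mul_mul_of_eq H.pq,
      mul_mul_of_eq H.ze, mul_mul_of_eq H.zh, mul_mul_of_eq H.zf, mul_mul_of_eq H.zp,
      mul_mul_of_eq H.zq]
    try module

theorem isWeylTriple {zz hh : ℂ} (hzz : zz ≠ 0)
    (H : IsSchrodingerTuple e h f p q (zz • (1 : R)))
    (hc : casimir e h f p q (zz • (1 : R)) = ((hh ^ 2 + 3 * hh + 2) * zz) • (1 : R)) :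
    IsWeylTriple zz (hh + 1 / 2) p q (e - (1 / (2 * zz)) • (p * p)) (f + (1 / (2 * zz)) • (q * q))
      (h + (1 / zz) • (q * p) + (1 / 2 : ℂ) • (1 : R)) := by
  have hfe : f * e = (1 / 4 : ℂ) • ((hh ^ 2 + 3 * hh + 2) • (1 : R) + (2 / zz) • (f * (p * p) -
      e * (q * q) - h * (p * q)) - h * h - h) := by
    have : (4 * zz) • (f * e) = ((hh ^ 2 + 3 * hh + 2) * zz) • (1 : R) + (2 : ℂ) • (f * (p * p) -
        e * (q * q) - h * (p * q)) - zz • (h * h) - zz • h := by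
      rw [← hc, casimir]
      simp only [mul_smul_comm, mul_one]
      module
    rw [← inv_smul_smul₀ (mul_ne_zero (by norm_num : (4 : ℂ) ≠ 0) hzz) (f * e), this]
    match_scalars <;> field_simp
  constructor
  case cas =>
    simp only [mul_assoc, add_mul, mul_add, mul_sub, smul_mul_assoc, mul_smul_comm, smul_add,
      smul_sub, smul_smul, mul_one, one_mul, hfe]
    simp only [mul_assoc, add_mul, mul_add, sub_mul, smul_mul_assoc, mul_smul_comm, smul_add,
      smul_sub, smul_smul, H.eq, H.hp, H.fp, H.pq, mul_mul_of_eq H.eq, mul_mul_of_eq H.fp,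
      mul_mul_of_eq H.hq, mul_mul_of_eq H.pq, mul_one, one_mul]
    match_scalars <;> field_simp <;> ring
  all_goals
    simp only [mul_assoc, add_mul, mul_add, sub_mul, mul_sub, smul_mul_assoc,
      mul_smul_comm, smul_add, smul_sub, smul_smul, mul_one, one_mul, H.he, H.ef, H.hf, H.eq,
      H.ep, H.hp, H.fp, H.fq, H.hq, H.pq, mul_mul_of_eq H.eq, mul_mul_of_eq H.hp,
      mul_mul_of_eq H.fp, mul_mul_of_eq H.fq, mul_mul_of_eq H.hq, mul_mul_of_eq H.pq]
    try (match_scalars <;> field_simp <;> ring)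

theorem adjoin_eq_top {zz : ℂ} (hgen : Algebra.adjoin ℂ {e, h, f, p, q, zz • (1 : R)} = ⊤) :
    Algebra.adjoin ℂ {p, q, e - (1 / (2 * zz)) • (p * p), f + (1 / (2 * zz)) • (q * q),
      h + (1 / zz) • (q * p) + (1 / 2 : ℂ) • (1 : R)} = ⊤ := by
  set A := Algebra.adjoin ℂ {p, q, e - (1 / (2 * zz)) • (p * p), f + (1 / (2 * zz)) • (q * q),
      h + (1 / zz) • (q * p) + (1 / 2 : ℂ) • (1 : R)} with hA
  have hp : p ∈ A := Algebra.subset_adjoin (by simp)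
  have hq : q ∈ A := Algebra.subset_adjoin (by simp)
  have he : e - (1 / (2 * zz)) • (p * p) ∈ A := Algebra.subset_adjoin (by simp)
  have hf : f + (1 / (2 * zz)) • (q * q) ∈ A := Algebra.subset_adjoin (by simp)
  have hh : h + (1 / zz) • (q * p) + (1 / 2 : ℂ) • (1 : R) ∈ A := Algebra.subset_adjoin (by simp)
  rw [eq_top_iff, ← hgen, Algebra.adjoin_le_iff]
  rintro x (rfl | rfl | rfl | rfl | rfl | rfl)
  · simpa using A.add_mem he (A.smul_mem (A.mul_mem hp hp) (1 / (2 * zz)))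
  · have := A.sub_mem (A.sub_mem hh (A.smul_mem A.one_mem (1 / 2)))
      (A.smul_mem (A.mul_mem hq hp) (1 / zz))
    rwa [add_sub_cancel_right, add_sub_cancel_right] at this
  · simpa using A.sub_mem hf (A.smul_mem (A.mul_mem hq hq) (1 / (2 * zz)))
  · exact hp
  · exact hq
  · exact A.smul_mem A.one_mem zz

end IsSchrodingerTuple

theorem IsWeylTriple.isSchrodingerTuple {R : Type*} [Ring R] [Algebra ℂ R] {zz μ : ℂ}
    {p q e f h : R} (hzz : zz ≠ 0) (H : IsWeylTriple zz μ p q e f h) :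
    IsSchrodingerTuple (e + (1 / (2 * zz)) • (p * p))
      (h - (1 / zz) • (q * p) - (1 / 2 : ℂ) • (1 : R))
      (f - (1 / (2 * zz)) • (q * q)) p q (zz • (1 : R)) := by
  constructor <;>
  · simp only [mul_assoc, add_mul, mul_add, sub_mul, mul_sub, smul_mul_assoc, mul_smul_comm,
      smul_add, smul_sub, smul_smul, mul_one, one_mul, H.he, H.ef, H.hf, ← H.qe, ← H.pe, ← H.qf,
      ← H.pf, ← H.qh, ← H.ph, H.pq, mul_mul_of_eq H.qe.symm,
      mul_mul_of_eq H.qf.symm, mul_mul_of_eq H.pf.symm, mul_mul_of_eq H.qh.symm,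
      mul_mul_of_eq H.ph.symm, mul_mul_of_eq H.pq]
    try (match_scalars <;> field_simp <;> ring)

theorem isSchrodingerTuple_gen : IsSchrodingerTuple E H F P Q Z where
  he := by simpa [E, H, gen, Algebra.smul_def, map_ofNat] using RingQuot.mkAlgHom_rel ℂ Rel.he
  ef := by simpa [E, H, F, P, Q, Z, gen] using RingQuot.mkAlgHom_rel ℂ Rel.ef
  hf := by simpa [F, H, gen, Algebra.smul_def, map_ofNat] using RingQuot.mkAlgHom_rel ℂ Rel.hf
  eq := by simpa [E, H, F, P, Q, Z, gen] using RingQuot.mkAlgHom_rel ℂ Rel.eq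
  ep := by simpa [E, H, F, P, Q, Z, gen] using RingQuot.mkAlgHom_rel ℂ Rel.ep
  hp := by simpa [E, H, F, P, Q, Z, gen] using RingQuot.mkAlgHom_rel ℂ Rel.hp
  fp := by simpa [E, H, F, P, Q, Z, gen] using RingQuot.mkAlgHom_rel ℂ Rel.fp
  fq := by simpa [E, H, F, P, Q, Z, gen] using RingQuot.mkAlgHom_rel ℂ Rel.fq
  hq := by simpa [E, H, F, P, Q, Z, gen] using RingQuot.mkAlgHom_rel ℂ Rel.hq
  pq := by simpa [E, H, F, P, Q, Z, gen] using RingQuot.mkAlgHom_rel ℂ Rel.pq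
  ze := by simpa [E, H, F, P, Q, Z, gen] using RingQuot.mkAlgHom_rel ℂ Rel.ze
  zh := by simpa [E, H, F, P, Q, Z, gen] using RingQuot.mkAlgHom_rel ℂ Rel.zh
  zf := by simpa [E, H, F, P, Q, Z, gen] using RingQuot.mkAlgHom_rel ℂ Rel.zf
  zp := by simpa [E, H, F, P, Q, Z, gen] using RingQuot.mkAlgHom_rel ℂ Rel.zp
  zq := by simpa [E, H, F, P, Q, Z, gen] using RingQuot.mkAlgHom_rel ℂ Rel.zq

theorem cElt_eq_casimir : cElt = casimir E H F P Q Z := by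
  simp [cElt, casimir, Algebra.smul_def, map_ofNat]

theorem adjoin_gen_eq_top : Algebra.adjoin ℂ ({E, H, F, P, Q, Z} : Set U) = ⊤ := by
  have h := congrArg (Subalgebra.map (RingQuot.mkAlgHom ℂ Rel)) (FreeAlgebra.adjoin_range_ι ℂ Gen)
  rw [AlgHom.map_adjoin, Algebra.map_top,
    (AlgHom.range_eq_top _).2 (RingQuot.mkAlgHom_surjective ℂ Rel)] at h
  rw [eq_top_iff, ← h]
  refine Algebra.adjoin_mono ?_
  rintro _ ⟨_, ⟨g, rfl⟩, rfl⟩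
  cases g
  · exact Or.inl rfl
  · exact Or.inr (Or.inl rfl)
  · exact Or.inr (Or.inr (Or.inl rfl))
  · exact Or.inr (Or.inr (Or.inr (Or.inl rfl)))
  · exact Or.inr (Or.inr (Or.inr (Or.inr (Or.inl rfl))))
  · exact Or.inr (Or.inr (Or.inr (Or.inr (Or.inr rfl))))

theorem commute_of_commute_gen {a : U} (ha : ∀ x ∈ ({E, H, F, P, Q, Z} : Set U), a * x = x * a)
    (u : U) : a * u = u * a := by
  have hu : u ∈ Algebra.adjoin ℂ ({E, H, F, P, Q, Z} : Set U) := by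
    rw [adjoin_gen_eq_top]; exact Algebra.mem_top
  induction hu using Algebra.adjoin_induction with
  | mem x hx => exact ha x hx
  | algebraMap c => exact (Algebra.commutes c a).symm
  | add x y _ _ hx hy => rw [mul_add, add_mul, hx, hy]
  | mul x y _ _ hx hy => rw [← mul_assoc, hx, mul_assoc, hy, mul_assoc]

theorem cElt_mul_comm (u : U) : cElt * u = u * cElt :=
  commute_of_commute_gen (fun _ hx => by
    rw [cElt_eq_casimir]; exact isSchrodingerTuple_gen.casimir_mul_comm hx) u

theorem Z_mul_comm (u : U) : Z * u = u * Z := by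
  refine commute_of_commute_gen (fun x hx => ?_) u
  have T := isSchrodingerTuple_gen
  rcases hx with rfl | rfl | rfl | rfl | rfl | rfl
  exacts [T.ze, T.zh, T.zf, T.zp, T.zq, rfl]

theorem exists_algHom_of_tuple {R : Type*} [Ring R] [Algebra ℂ R] {e h f p q z : R}
    (T : IsSchrodingerTuple e h f p q z) : ∃ φ : U →ₐ[ℂ] R,
      φ E = e ∧ φ H = h ∧ φ F = f ∧ φ P = p ∧ φ Q = q ∧ φ Z = z := by
  let v : Gen → R := fun g => match g with
    | .E => e | .H => h | .F => f | .P => p | .Q => q | .Z => z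
  have hv (g : Gen) : FreeAlgebra.lift ℂ v (ιg g) = v g := FreeAlgebra.lift_ι_apply _ _
  refine ⟨RingQuot.liftAlgHom ℂ ⟨FreeAlgebra.lift ℂ v, fun x y hxy => ?_⟩, ?_⟩
  · have h2 (x : R) : 2 * x = (2 : ℂ) • x := by simp [Algebra.smul_def, map_ofNat]
    cases hxy <;> simp only [map_mul, map_add, map_sub, map_ofNat, hv, h2, v]
    exacts [T.he, T.ef, T.hf, T.eq, T.ep, T.hp, T.fp, T.fq, T.hq, T.pq, T.ze, T.zh, T.zf, T.zp,
      T.zq]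
  · refine ⟨?_, ?_, ?_, ?_, ?_, ?_⟩ <;>
    exact (RingQuot.liftAlgHom_mkAlgHom_apply _ _ _ _).trans (hv _)

/-- The Fock space model of the Verma module as a module over a Weyl triple. -/
theorem exists_isWeylTriple_model (zz μ : ℂ) :
    ∃ p q e f h : Module.End ℂ (ℕ → ℕ → ℂ), IsWeylTriple zz μ p q e f h ∧
      ∃ v : ℕ → ℕ → ℂ, v ≠ 0 ∧ e v = 0 ∧ p v = 0 ∧ h v = μ • v := by
  let p : Module.End ℂ (ℕ → ℕ → ℂ) :=
    { toFun := fun ψ i j => zz * (j + 1) * ψ i (j + 1)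
      map_add' := fun ψ φ => by funext i j; simp only [Pi.add_apply]; ring
      map_smul' := fun c ψ => by
        funext i j; simp only [Pi.smul_apply, smul_eq_mul, RingHom.id_apply]; ring }
  let q : Module.End ℂ (ℕ → ℕ → ℂ) :=
    { toFun := fun ψ i j => Nat.casesOn j 0 (ψ i)
      map_add' := fun ψ φ => by funext i j; cases j <;> simp
      map_smul' := fun c ψ => by funext i j; cases j <;> simp }
  let e : Module.End ℂ (ℕ → ℕ → ℂ) :=
    { toFun := fun ψ i j => (i + 1) * (μ - i) * ψ (i + 1) j
      map_add' := fun ψ φ => by funext i j; simp only [Pi.add_apply]; ring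
      map_smul' := fun c ψ => by
        funext i j; simp only [Pi.smul_apply, smul_eq_mul, RingHom.id_apply]; ring }
  let f : Module.End ℂ (ℕ → ℕ → ℂ) :=
    { toFun := fun ψ i j => Nat.casesOn i 0 (fun i => ψ i j)
      map_add' := fun ψ φ => by funext i j; cases i <;> simp
      map_smul' := fun c ψ => by funext i j; cases i <;> simp }
  let h : Module.End ℂ (ℕ → ℕ → ℂ) :=
    { toFun := fun ψ i j => (μ - 2 * i) * ψ i j
      map_add' := fun ψ φ => by funext i j; simp only [Pi.add_apply]; ring
      map_smul' := fun c ψ => by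
        funext i j; simp only [Pi.smul_apply, smul_eq_mul, RingHom.id_apply]; ring }
  refine ⟨p, q, e, f, h, ?_, fun i j => if i = 0 ∧ j = 0 then 1 else 0, ?_, ?_, ?_, ?_⟩
  · constructor <;>
    · refine LinearMap.ext fun ψ => funext fun i => funext fun j => ?_
      rcases i with _ | i <;> rcases j with _ | j <;>
      · simp [p, q, e, f, h]
        try ring
  · intro h0
    simpa using congrFun (congrFun h0 0) 0
  · funext i j
    simp [e]
  · funext i j
    simp [p]
  · funext i j
    by_cases hij : i = 0 ∧ j = 0
    · simp [h, hij.1, hij.2]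
    · simp [h, hij]

theorem hwVec_ne_zero (hh : ℂ) {zz : ℂ} (hzz : zz ≠ 0) : hwVec hh zz ≠ 0 := by
  obtain ⟨p, q, e, f, h, T, v, hv0, hev, hpv, hhv⟩ := exists_isWeylTriple_model zz (hh + 1 / 2)
  obtain ⟨φ, hE, hH, -, hP, -, hZ⟩ := exists_algHom_of_tuple (T.isSchrodingerTuple hzz)
  let N : Submodule U U :=
    { carrier := {u | φ u v = 0}
      add_mem' := fun {a b} (ha : φ a v = 0) (hb : φ b v = 0) =>
        show φ (a + b) v = 0 by rw [map_add, LinearMap.add_apply, ha, hb, add_zero]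
      zero_mem' := show φ 0 v = 0 by simp
      smul_mem' := fun a b (hb : φ b v = 0) =>
        show φ (a * b) v = 0 by rw [map_mul, Module.End.mul_apply, hb, map_zero] }
  have hN : vermaIdeal hh zz ≤ N := by
    refine Submodule.span_le.2 ?_
    rintro x (rfl | rfl | rfl | rfl)
    · change φ E v = 0
      simp [hE, hev, hpv]
    · change φ P v = 0
      rw [hP, hpv]
    · change φ (H - sc hh) v = 0
      rw [map_sub, hH, sc, AlgHom.commutes]
      simp only [LinearMap.sub_apply, LinearMap.smul_apply, Module.End.mul_apply, hpv, map_zero,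
        smul_zero, Module.algebraMap_end_apply, Module.End.one_apply, hhv]
      module
    · change φ (Z - sc zz) v = 0
      rw [map_sub, hZ, sc, AlgHom.commutes]
      simp
  intro h0
  have h1 : (1 : U) ∈ vermaIdeal hh zz := (Submodule.Quotient.mk_eq_zero _).1 h0
  have h2 : φ 1 v = 0 := hN h1
  rw [map_one] at h2
  exact hv0 h2

noncomputable section

/-- The component of `e` commuting with `p` and `q` in `U_λ`. -/
def weylE (hh zz : ℂ) : UQuot hh zz := uquotMap hh zz (E - (1 / (2 * zz)) • (P * P))

/-- The component of `f` commuting with `p` and `q` in `U_λ`. -/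
def weylF (hh zz : ℂ) : UQuot hh zz := uquotMap hh zz (F + (1 / (2 * zz)) • (Q * Q))

/-- The component of `h` commuting with `p` and `q` in `U_λ`. -/
def weylH (hh zz : ℂ) : UQuot hh zz :=
  uquotMap hh zz (H + (1 / zz) • (Q * P) + (1 / 2 : ℂ) • (1 : U))

theorem uquotMap_eq_mkAlgHom (hh zz : ℂ) (u : U) :
    uquotMap hh zz u = RingQuot.mkAlgHom ℂ (CRel hh zz) u := by
  rw [uquotMap, ← RingQuot.mkAlgHom_coe ℂ]
  rfl

theorem uquotMap_surjective (hh zz : ℂ) : Function.Surjective (uquotMap hh zz) :=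
  RingQuot.mkRingHom_surjective _

theorem uquotMap_Z (hh zz : ℂ) : uquotMap hh zz Z = zz • (1 : UQuot hh zz) := by
  rw [uquotMap, RingQuot.mkRingHom_rel CRel.z, ← uquotMap, uquotMap_eq_mkAlgHom, sc,
    AlgHom.commutes, Algebra.algebraMap_eq_smul_one]

theorem uquotMap_cElt (hh zz : ℂ) :
    uquotMap hh zz cElt = vartheta hh zz • (1 : UQuot hh zz) := by
  rw [uquotMap, RingQuot.mkRingHom_rel CRel.c, ← uquotMap, uquotMap_eq_mkAlgHom, sc,
    AlgHom.commutes, Algebra.algebraMap_eq_smul_one]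

theorem isWeylTriple_uquot (hh : ℂ) {zz : ℂ} (hzz : zz ≠ 0) :
    IsWeylTriple zz (hh + 1 / 2) (uquotMap hh zz P) (uquotMap hh zz Q) (weylE hh zz)
      (weylF hh zz) (weylH hh zz) := by
  have T := isSchrodingerTuple_gen.map (RingQuot.mkAlgHom ℂ (CRel hh zz))
  have hc := uquotMap_cElt hh zz
  rw [cElt_eq_casimir, vartheta] at hc
  simp only [casimir, uquotMap_eq_mkAlgHom, map_sub, map_add, map_mul, map_smul] at hc
  have hZ := uquotMap_Z hh zz
  rw [uquotMap_eq_mkAlgHom] at hZ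
  rw [hZ] at T hc
  have := T.isWeylTriple hzz hc
  simpa only [weylE, weylF, weylH, uquotMap_eq_mkAlgHom, map_sub, map_add, map_mul, map_smul,
    map_one] using this

theorem adjoin_weyl_eq_top (hh zz : ℂ) :
    Algebra.adjoin ℂ {uquotMap hh zz P, uquotMap hh zz Q, weylE hh zz, weylF hh zz, weylH hh zz} =
      ⊤ := by
  have h := congrArg (Subalgebra.map (RingQuot.mkAlgHom ℂ (CRel hh zz))) adjoin_gen_eq_top
  have hZ := uquotMap_Z hh zz
  rw [uquotMap_eq_mkAlgHom] at hZ
  rw [AlgHom.map_adjoin, Algebra.map_top,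
    (AlgHom.range_eq_top _).2 (RingQuot.mkAlgHom_surjective ℂ _)] at h
  simp only [Set.image_insert_eq, Set.image_singleton, hZ] at h
  have := IsSchrodingerTuple.adjoin_eq_top h
  simpa only [weylE, weylF, weylH, uquotMap_eq_mkAlgHom, map_sub, map_add, map_mul, map_smul,
    map_one] using this

/-- `M` is generated by a highest weight vector `v` of weight `λ`. -/
structure IsHighestWeightGenerator (hh zz : ℂ) {M : Type} [AddCommGroup M] [Module U M]
    (v : M) : Prop where
  E_smul : E • v = 0
  P_smul : P • v = 0
  H_smul : H • v = sc hh • v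
  Z_smul : Z • v = sc zz • v
  exists_smul_eq : ∀ x : M, ∃ u : U, u • v = x

namespace IsHighestWeightGenerator

variable {hh zz : ℂ} {M : Type} [AddCommGroup M] [Module U M] {v : M}

theorem Z_smul_apply (hv : IsHighestWeightGenerator hh zz v) (x : M) : Z • x = sc zz • x := by
  obtain ⟨u, rfl⟩ := hv.exists_smul_eq x
  rw [← mul_smul, Z_mul_comm, mul_smul, hv.Z_smul, ← mul_smul, ← mul_smul, sc,
    Algebra.commutes]

theorem cElt_smul (hv : IsHighestWeightGenerator hh zz v) :
    cElt • v = sc (vartheta hh zz) • v := by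
  let _ : Module ℂ M := Module.compHom M (algebraMap ℂ U)
  have : IsScalarTower ℂ U M := ⟨fun c u x => by
    rw [Algebra.smul_def, mul_smul]; rfl⟩
  have hsc (c : ℂ) (x : M) : sc c • x = c • x := rfl
  have T := isSchrodingerTuple_gen
  have hpq : (P * Q) • v = zz • v := by
    rw [T.pq, add_smul, mul_smul, hv.P_smul, smul_zero, zero_add, hv.Z_smul, hsc]
  have hqq : (E * (Q * Q)) • v = zz • v := by
    rw [← mul_assoc, T.eq, add_mul, add_smul, hpq, mul_assoc, T.eq, mul_smul, add_smul, mul_smul,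
      hv.E_smul, hv.P_smul]
    simp
  have hH (c : ℂ) : H • c • v = (c * hh) • v := by
    rw [smul_complex_smul, hv.H_smul, hsc, smul_smul]
  rw [cElt_eq_casimir, casimir]
  simp only [sub_smul, add_smul, mul_smul _ Z, smul_assoc, hqq, hv.Z_smul, hsc]
  simp only [mul_smul, smul_complex_smul (R := U), hv.E_smul, hv.P_smul, hv.H_smul, hsc, smul_zero]
  rw [← mul_smul P, hpq, hH, vartheta]
  module

theorem cElt_smul_apply (hv : IsHighestWeightGenerator hh zz v) (x : M) :
    cElt • x = sc (vartheta hh zz) • x := by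
  obtain ⟨u, rfl⟩ := hv.exists_smul_eq x
  rw [← mul_smul, cElt_mul_comm, mul_smul, hv.cElt_smul, ← mul_smul, ← mul_smul, sc,
    Algebra.commutes]

theorem exists_module_uquot {hh' : ℂ} (hv : IsHighestWeightGenerator hh' zz v)
    (hϑ : vartheta hh' zz = vartheta hh zz) :
    ∃ _ : Module (UQuot hh zz) M, ∀ (u : U) (x : M), uquotMap hh zz u • x = u • x := by
  let φ : UQuot hh zz →+* AddMonoid.End M := RingQuot.lift ⟨Module.toAddMonoidEnd U M, by
    rintro _ _ (_ | _)
    · exact AddMonoidHom.ext hv.Z_smul_apply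
    · exact AddMonoidHom.ext (hϑ ▸ hv.cElt_smul_apply)⟩
  refine ⟨Module.compHom M φ, fun u x => ?_⟩
  change φ (RingQuot.mkRingHom _ u) x = u • x
  rw [RingQuot.lift_mkRingHom_apply]
  rfl

theorem isHighestWeight {hh' : ℂ} (hv : IsHighestWeightGenerator hh' zz v)
    [Module ℂ M] [Module (UQuot hh zz) M] [IsScalarTower ℂ (UQuot hh zz) M]
    (hM : ∀ (u : U) (x : M), uquotMap hh zz u • x = u • x) :
    IsHighestWeight (uquotMap hh zz P) (weylE hh zz) (weylH hh zz) (hh' + 1 / 2) v := by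
  have hsmul (c : ℂ) (u : U) (x : M) : uquotMap hh zz (c • u) • x = c • u • x := by
    rw [uquotMap_eq_mkAlgHom, map_smul, ← uquotMap_eq_mkAlgHom, smul_assoc, hM]
  have hsc (c : ℂ) (x : M) : sc c • x = c • x := by
    rw [← hM, sc, Algebra.algebraMap_eq_smul_one, hsmul, one_smul]
  constructor
  · rw [weylE, map_sub, sub_smul, hsmul, hM, mul_smul, hv.E_smul, hv.P_smul]
    simp
  · rw [hM, hv.P_smul]
  · rw [weylH, map_add, map_add, add_smul, add_smul, hsmul, hsmul, hM, mul_smul, hv.P_smul,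
      hv.H_smul, hsc, one_smul]
    simp [add_smul]

theorem sSup_ne_top (hv : IsHighestWeightGenerator hh zz v) (hzz : zz ≠ 0) (hv0 : v ≠ 0) :
    sSup {N : Submodule U M | N ≠ ⊤} ≠ ⊤ := by
  obtain ⟨_, hM⟩ := hv.exists_module_uquot (hh := hh) rfl
  let _ : Module ℂ M := Module.compHom M (algebraMap ℂ (UQuot hh zz))
  have : IsScalarTower ℂ (UQuot hh zz) M := IsScalarTower.of_compHom ℂ (UQuot hh zz) M
  have hcyc (x : M) : ∃ a : UQuot hh zz, a • v = x := by
    obtain ⟨u, rfl⟩ := hv.exists_smul_eq x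
    exact ⟨_, hM u v⟩
  have hA := (isWeylTriple_uquot hh hzz).sSup_ne_top (adjoin_weyl_eq_top hh zz) hzz
    (hv.isHighestWeight hM) hcyc hv0
  intro htop
  let S : Submodule U M :=
    { (sSup {N : Submodule (UQuot hh zz) M | N ≠ ⊤}).toAddSubmonoid with
      smul_mem' := fun u x hx => hM u x ▸ Submodule.smul_mem _ _ hx }
  have hS : sSup {N : Submodule U M | N ≠ ⊤} ≤ S := by
    refine sSup_le fun N hN x hx => ?_
    let N' : Submodule (UQuot hh zz) M :=
      { N.toAddSubmonoid with
        smul_mem' := fun a x hx => by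
          obtain ⟨u, rfl⟩ := uquotMap_surjective hh zz a
          rw [hM]
          exact N.smul_mem u hx }
    have hN' : N' ≠ ⊤ := fun h => hN (eq_top_iff.2 fun y _ =>
      show y ∈ N' from h ▸ Submodule.mem_top)
    exact (le_sSup hN' : N' ≤ _) hx
  rw [htop] at hS
  exact hA (eq_top_iff.2 fun x _ => hS (Submodule.mem_top (x := x)))

end IsHighestWeightGenerator

theorem isHighestWeightGenerator_hwVec (hh zz : ℂ) :
    IsHighestWeightGenerator hh zz (hwVec hh zz) := by
  have hmk (u : U) : u • hwVec hh zz = Submodule.Quotient.mk u := by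
    rw [hwVec, ← Submodule.Quotient.mk_smul, smul_eq_mul, mul_one]
  have hmem (u : U) (hu : u ∈ ({E, P, H - sc hh, Z - sc zz} : Set U)) : u • hwVec hh zz = 0 := by
    rw [hmk, Submodule.Quotient.mk_eq_zero]
    exact Submodule.subset_span hu
  refine ⟨hmem _ (by simp), hmem _ (by simp), ?_, ?_, fun x => ?_⟩
  · rw [← sub_eq_zero, ← sub_smul]; exact hmem _ (by simp)
  · rw [← sub_eq_zero, ← sub_smul]; exact hmem _ (by simp)
  · obtain ⟨u, rfl⟩ := Submodule.Quotient.mk_surjective _ x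
    exact ⟨u, hmk u⟩

theorem isHighestWeightGenerator_mk (hh zz : ℂ) : IsHighestWeightGenerator hh zz
    (Submodule.Quotient.mk (hwVec hh zz) : SimpleHW hh zz) := by
  have hv := isHighestWeightGenerator_hwVec hh zz
  refine ⟨?_, ?_, ?_, ?_, fun x => ?_⟩
  · rw [← Submodule.Quotient.mk_smul, hv.E_smul, Submodule.Quotient.mk_zero]
  · rw [← Submodule.Quotient.mk_smul, hv.P_smul, Submodule.Quotient.mk_zero]
  · rw [← Submodule.Quotient.mk_smul, hv.H_smul, Submodule.Quotient.mk_smul]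
  · rw [← Submodule.Quotient.mk_smul, hv.Z_smul, Submodule.Quotient.mk_smul]
  · obtain ⟨y, rfl⟩ := Submodule.Quotient.mk_surjective _ x
    obtain ⟨u, rfl⟩ := hv.exists_smul_eq y
    exact ⟨u, rfl⟩

theorem isSimpleModule_simpleHW (hh : ℂ) {zz : ℂ} (hzz : zz ≠ 0) :
    IsSimpleModule U (SimpleHW hh zz) := by
  rw [isSimpleModule_iff_isCoatom]
  refine ⟨(isHighestWeightGenerator_hwVec hh zz).sSup_ne_top hzz (hwVec_ne_zero hh hzz),
    fun N hN => ?_⟩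
  by_contra hne
  exact hN.not_ge (le_sSup hne)

theorem mk_hwVec_ne_zero (hh : ℂ) {zz : ℂ} (hzz : zz ≠ 0) :
    (Submodule.Quotient.mk (hwVec hh zz) : SimpleHW hh zz) ≠ 0 := by
  intro h0
  have := isSimpleModule_simpleHW hh hzz
  have := IsSimpleModule.nontrivial U (SimpleHW hh zz)
  obtain ⟨x, hx⟩ := exists_ne (0 : SimpleHW hh zz)
  obtain ⟨u, rfl⟩ := (isHighestWeightGenerator_mk hh zz).exists_smul_eq x
  exact hx (by rw [h0, smul_zero])

theorem isSimpleModule_uquot {hh zz : ℂ} {M : Type} [AddCommGroup M] [Module U M]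
    [Module (UQuot hh zz) M] (hM : ∀ (u : U) (x : M), uquotMap hh zz u • x = u • x)
    [IsSimpleModule U M] : IsSimpleModule (UQuot hh zz) M := by
  rw [isSimpleModule_iff_toSpanSingleton_surjective]
  refine ⟨IsSimpleModule.nontrivial U M, fun x hx y => ?_⟩
  obtain ⟨u, hu⟩ := IsSimpleModule.toSpanSingleton_surjective U hx y
  exact ⟨uquotMap hh zz u, (hM u x).trans hu⟩

/-- The annihilator of a module, as a two-sided ideal. -/
def annTwoSided (A M : Type) [Ring A] [AddCommGroup M] [Module A M] : TwoSidedIdeal A :=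
  TwoSidedIdeal.ker (Module.toAddMonoidEnd A M)

theorem mem_annTwoSided {A M : Type} [Ring A] [AddCommGroup M] [Module A M] {a : A} :
    a ∈ annTwoSided A M ↔ ∀ x : M, a • x = 0 := by
  rw [annTwoSided, TwoSidedIdeal.mem_ker]
  exact DFunLike.ext_iff

theorem annTwoSided_ne_top (A M : Type) [Ring A] [AddCommGroup M] [Module A M] [Nontrivial M] :
    annTwoSided A M ≠ ⊤ := by
  intro h
  obtain ⟨x, hx⟩ := exists_ne (0 : M)
  have h1 : (1 : A) ∈ annTwoSided A M := (TwoSidedIdeal.one_mem_iff _).2 h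
  exact hx (by rw [← one_smul A x, mem_annTwoSided.1 h1])

theorem isPrimitiveIdeal_iff {A : Type} [Ring A] {I : TwoSidedIdeal A} : IsPrimitiveIdeal I ↔
    ∃ (M : Type) (_ : AddCommGroup M) (_ : Module A M),
      IsSimpleModule A M ∧ I = annTwoSided A M := by
  constructor
  · rintro ⟨M, hM, hI⟩
    exact ⟨M, inferInstance, inferInstance, hM,
      SetLike.ext fun x => (hI x).trans mem_annTwoSided.symm⟩
  · rintro ⟨M, _, _, hM, rfl⟩
    exact ⟨ModuleCat.of A M, hM, fun x => mem_annTwoSided⟩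

theorem nontrivial_uquot (hh : ℂ) {zz : ℂ} (hzz : zz ≠ 0) : Nontrivial (UQuot hh zz) := by
  obtain ⟨_, -⟩ := (isHighestWeightGenerator_hwVec hh zz).exists_module_uquot (hh := hh) rfl
  have : Nontrivial (Verma hh zz) := nontrivial_of_ne _ _ (hwVec_ne_zero hh hzz)
  exact Module.nontrivial (UQuot hh zz) (Verma hh zz)

theorem eq_bot_or_eq_top_of_eigenvalue {hh zz : ℂ} (hzz : zz ≠ 0)
    (hμ : ∀ i : ℕ, hh + 1 / 2 ≠ i ∧ hh + 1 / 2 ≠ -i - 2) (I : TwoSidedIdeal (UQuot hh zz)) :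
    I = ⊥ ∨ I = ⊤ := by
  refine or_iff_not_imp_left.2 fun hI => ?_
  obtain ⟨n, hn⟩ := (isWeylTriple_uquot hh hzz).exists_e_pow_mem (adjoin_weyl_eq_top hh zz) hzz I hI
  exact (isWeylTriple_uquot hh hzz).eq_top_of_e_pow_mem I (fun i _ => hμ i) hn

/-- If `λ(h) + 1/2 = -m - 2` with `m` a natural number, the annihilator of a highest weight module
contains no power of `weylE`. -/
theorem IsHighestWeightGenerator.exists_e_pow_smul_ne_zero {m : ℕ} {hh zz : ℂ} {M : Type}
    [AddCommGroup M] [Module U M] [Module (UQuot hh zz) M] {v : M} (hzz : zz ≠ 0)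
    (hv : IsHighestWeightGenerator (-m - 5 / 2) zz v) (hv0 : v ≠ 0)
    (hM : ∀ (u : U) (x : M), uquotMap hh zz u • x = u • x) (n : ℕ) :
    ∃ x : M, weylE hh zz ^ n • x ≠ 0 := by
  let _ : Module ℂ M := Module.compHom M (algebraMap ℂ (UQuot hh zz))
  have : IsScalarTower ℂ (UQuot hh zz) M := IsScalarTower.of_compHom ℂ (UQuot hh zz) M
  have hw := hv.isHighestWeight hM
  refine ⟨_, (isWeylTriple_uquot hh hzz).e_pow_smul_f_pow_smul_ne_zero hw.e_smul hw.h_smul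
    (fun i hi => ?_) hv0 n⟩
  have : (m + i + 2 : ℂ) = 0 := by linear_combination -hi
  exact absurd this (by exact_mod_cast (by omega : m + i + 2 ≠ 0))

theorem IsHighestWeightGenerator.isPrimitiveIdeal_bot {m : ℕ} {hh zz : ℂ} {M : Type}
    [AddCommGroup M] [Module U M] [IsSimpleModule U M] {v : M} (hzz : zz ≠ 0)
    (hv : IsHighestWeightGenerator (-m - 5 / 2) zz v) (hv0 : v ≠ 0) (hm : hh = (m : ℂ) - 1 / 2) :
    IsPrimitiveIdeal (⊥ : TwoSidedIdeal (UQuot hh zz)) ∧ ∀ n, weylE hh zz ^ n ≠ 0 := by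
  obtain ⟨_, hM⟩ := hv.exists_module_uquot (hh := hh) (by simp only [vartheta, hm]; ring)
  have he := hv.exists_e_pow_smul_ne_zero hzz hv0 hM
  refine ⟨isPrimitiveIdeal_iff.2 ⟨M, inferInstance, inferInstance, isSimpleModule_uquot hM, ?_⟩,
    fun n hn => ?_⟩
  · by_contra hne
    obtain ⟨n, hn⟩ := (isWeylTriple_uquot hh hzz).exists_e_pow_mem (adjoin_weyl_eq_top hh zz) hzz _
      (Ne.symm hne)
    obtain ⟨x, hx⟩ := he n
    exact hx (mem_annTwoSided.1 hn x)
  · obtain ⟨x, hx⟩ := he n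
    exact hx (by rw [hn, zero_smul])

theorem IsHighestWeightGenerator.exists_twoSidedIdeal {m : ℕ} {hh zz : ℂ} {M : Type}
    [AddCommGroup M] [Module U M] [IsSimpleModule U M] {v : M} (hzz : zz ≠ 0)
    (hv : IsHighestWeightGenerator hh zz v) (hv0 : v ≠ 0) (hm : hh = (m : ℂ) - 1 / 2) :
    ∃ K : TwoSidedIdeal (UQuot hh zz), IsPrimitiveIdeal K ∧ K ≠ ⊤ ∧ weylE hh zz ^ (m + 1) ∈ K ∧
      (K : Set (UQuot hh zz)) = uquotMap hh zz '' {u : U | ∀ x : M, u • x = 0} := by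
  obtain ⟨_, hM⟩ := hv.exists_module_uquot (hh := hh) rfl
  let _ : Module ℂ M := Module.compHom M (algebraMap ℂ (UQuot hh zz))
  have : IsScalarTower ℂ (UQuot hh zz) M := IsScalarTower.of_compHom ℂ (UQuot hh zz) M
  have hA : IsSimpleModule (UQuot hh zz) M := isSimpleModule_uquot hM
  have := nontrivial_of_ne v 0 hv0
  have hμ : hh + 1 / 2 = m := by rw [hm]; ring
  have hw := hv.isHighestWeight hM
  rw [hμ] at hw
  refine ⟨annTwoSided _ M, isPrimitiveIdeal_iff.2 ⟨M, _, _, hA, rfl⟩, annTwoSided_ne_top _ M,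
    mem_annTwoSided.2 ((isWeylTriple_uquot hh hzz).e_pow_smul_eq_zero (adjoin_weyl_eq_top hh zz)
      hw hv0), Set.ext fun a => ⟨fun ha => ?_, ?_⟩⟩
  · obtain ⟨u, rfl⟩ := uquotMap_surjective hh zz a
    exact ⟨u, fun x => (hM u x).symm.trans (mem_annTwoSided.1 ha x), rfl⟩
  · rintro ⟨u, hu, rfl⟩
    exact mem_annTwoSided.2 fun x => (hM u x).trans (hu x)

theorem IsPrimitiveIdeal.ne_top {A : Type} [Ring A] {I : TwoSidedIdeal A}
    (hI : IsPrimitiveIdeal I) : I ≠ ⊤ := by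
  obtain ⟨M, _, _, hM, rfl⟩ := isPrimitiveIdeal_iff.1 hI
  have := IsSimpleModule.nontrivial A M
  exact annTwoSided_ne_top A M

/-- Theorem 777 of the paper: let `λ ∈ 𝔥*` with
`λ(z) = zz ≠ 0`, and let `U_λ := U/U·m_λ`.  Then:
(i) if `λ(h) ∉ ½ + ℤ` or `λ(h) = -3/2`, the algebra `U_λ` is simple;
(ii) if `λ(h) ∈ {-1/2, 1/2, 3/2, 5/2, …}`, then `U_λ` has exactly two primitive
ideals, namely `0` and the image of `Ann_U(L(λ))`. -/
theorem central_quotient_primitive_ideals (hh zz : ℂ) (hzz : zz ≠ 0) :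
    (((∀ k : ℤ, hh ≠ (k : ℂ) + 1 / 2) ∨ hh = -(3 / 2)) →
      Nontrivial (UQuot hh zz) ∧
      ∀ I : TwoSidedIdeal (UQuot hh zz), I = ⊥ ∨ I = ⊤) ∧
    ((∃ m : ℕ, hh = (m : ℂ) - 1 / 2) →
      (∀ I : TwoSidedIdeal (UQuot hh zz),
        IsPrimitiveIdeal I ↔
          (I = ⊥ ∨ (I : Set (UQuot hh zz)) =
            uquotMap hh zz '' {u : U | ∀ v : SimpleHW hh zz, u • v = 0})) ∧
      ((⊥ : TwoSidedIdeal (UQuot hh zz)) : Set (UQuot hh zz)) ≠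
        uquotMap hh zz '' {u : U | ∀ v : SimpleHW hh zz, u • v = 0}) := by
  refine ⟨fun hhh => ⟨nontrivial_uquot hh hzz, eq_bot_or_eq_top_of_eigenvalue hzz fun i => ?_⟩, ?_⟩
  · rcases hhh with hhh | rfl
    · exact ⟨fun hi => hhh (i - 1) (by push_cast; linear_combination hi),
        fun hi => hhh (-i - 3) (by push_cast; linear_combination hi)⟩
    · refine ⟨fun hi => ?_, fun hi => ?_⟩
      · have : (i + 1 : ℂ) = 0 := by linear_combination -hi
        exact absurd this (by exact_mod_cast i.succ_ne_zero)
      · have : (i + 1 : ℂ) = 0 := by linear_combination hi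
        exact absurd this (by exact_mod_cast i.succ_ne_zero)
  rintro ⟨m, hm⟩
  have := isSimpleModule_simpleHW hh hzz
  have := isSimpleModule_simpleHW (-m - 5 / 2) hzz
  obtain ⟨hbot, he⟩ := (isHighestWeightGenerator_mk (-m - 5 / 2) zz).isPrimitiveIdeal_bot hzz
    (mk_hwVec_ne_zero _ hzz) hm
  obtain ⟨K, hK, hK1, hKe, hKL⟩ := (isHighestWeightGenerator_mk hh zz).exists_twoSidedIdeal hzz
    (mk_hwVec_ne_zero hh hzz) hm
  have hK0 : K ≠ ⊥ := by
    rintro rfl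
    exact he _ ((TwoSidedIdeal.mem_bot _).1 hKe)
  have T := isWeylTriple_uquot hh hzz
  rw [show hh + 1 / 2 = m by rw [hm]; ring] at T
  rw [← hKL]
  refine ⟨fun I => ⟨fun hI => or_iff_not_imp_left.2 fun hI0 => ?_, ?_⟩,
    fun h => hK0 (SetLike.coe_injective h).symm⟩
  · rw [T.eq_of_ne_bot_of_ne_top (adjoin_weyl_eq_top hh zz) hzz hI0 hI.ne_top hK0 hK1]
  · rintro (rfl | h)
    · exact hbot
    · exact SetLike.coe_injective h ▸ hK

end

end Schrodinger
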